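/- Let d ≥ 2 and let p,q > d/2 satisfy 1/p + 1/q < 2/d. For all α > 0, σ > 0 and ω ∈ Ω_{p,q}, there exist R₀ ≥ 1 and c̃₁ = c̃₁(α,σ,ω) ∈ [1,∞) such that for all R ≥ R₀ and all t ≥ 0, max_{x∈Λ_R} P_ω^x( H_{Λ_{σR}(x)} ≤ t ) ≤ c̃₁ (t/R²)^α. -/

import Mathlib

open MeasureTheory Filter Topology Matrix
open scoped ENNReal NNReal

noncomputable section

namespace DetCond

/-- Vertices of `ℤ^d`. -/
abbrev Vert (d : ℕ) := Fin d → ℤ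

/-- Index of the (unordered) nearest-neighbour edge `(x, x + e i)` of `ℤ^d`;
the set of these indices is in natural bijection with `E(ℤ^d)` modulo orientation. -/
abbrev EdgeIx (d : ℕ) := Vert d × Fin d

/-- The space `Ω = (0,∞)^{E(ℤ^d)}` of (symmetric) conductance configurations, with
its product topology and product σ-algebra. -/
abbrev EnvSp (d : ℕ) := {ω : EdgeIx d → ℝ // ∀ e, 0 < ω e}

/-- The `i`-th coordinate unit vector of `ℤ^d`. -/
def unitv (d : ℕ) (i : Fin d) : Vert d := fun j => if j = i then 1 else 0

/-- The translation `τ_x` acting on environments: `c_{τ_x ω}(y,z) = c_ω(y+x,z+x)`. -/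
def shift (d : ℕ) (x : Vert d) (ω : EnvSp d) : EnvSp d :=
  ⟨fun e => ω.1 (e.1 + x, e.2), fun e => ω.2 (e.1 + x, e.2)⟩

/-- The conductance `c_ω(x,y)`; it vanishes when `x,y` are not nearest neighbours
and is symmetric in `x,y` by construction. -/
def cnd (d : ℕ) (ω : EnvSp d) (x y : Vert d) : ℝ :=
  ∑ i, ((if y = x + unitv d i then ω.1 (x, i) else 0) +
        (if x = y + unitv d i then ω.1 (y, i) else 0))

/-- `π_ω(x) = Σ_{z : (x,z) ∈ E(ℤ^d)} c_ω(x,z)`. -/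
def piOf (d : ℕ) (ω : EnvSp d) (x : Vert d) : ℝ :=
  ∑ i, (ω.1 (x, i) + ω.1 (x - unitv d i, i))

/-- The box `Λ_r = [-r,r]^d ∩ ℤ^d`. -/
def box (d : ℕ) (r : ℝ) : Finset (Vert d) :=
  Fintype.piFinset fun _ : Fin d => Finset.Icc ⌈-r⌉ ⌊r⌋

/-- The nearest neighbours of `x` in `ℤ^d`. -/
def nbrs (d : ℕ) (x : Vert d) : Finset (Vert d) :=
  (Finset.univ.image fun i => x + unitv d i) ∪ (Finset.univ.image fun i => x - unitv d i)

/-- The set `E(Λ)` of edges incident with at least one vertex of `Λ`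
(one index per unordered edge). -/
def edgesIn (d : ℕ) (Λ : Finset (Vert d)) : Finset (EdgeIx d) :=
  Λ.biUnion fun x =>
    (Finset.univ.image fun i => (x, i)) ∪ (Finset.univ.image fun i => (x - unitv d i, i))

/-- Bounded functions on `Ω`. -/
def IsBdd (d : ℕ) (f : EnvSp d → ℝ) : Prop := ∃ M, ∀ ω, |f ω| ≤ M

/-- Local functions: `f` depends only on the coordinates in some finite set `B` of edges
and, viewed as a function of those coordinates, has compact support in `(0,∞)^B`. -/
def IsLocalFn (d : ℕ) (f : EnvSp d → ℝ) : Prop :=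
  ∃ B : Finset (EdgeIx d),
    (∀ ω₁ ω₂ : EnvSp d, (∀ e ∈ B, ω₁.1 e = ω₂.1 e) → f ω₁ = f ω₂) ∧
    ∃ a b : ℝ, 0 < a ∧ ∀ ω : EnvSp d, (∃ e ∈ B, ω.1 e < a ∨ b < ω.1 e) → f ω = 0

/-- `ℓ_ω(f) = L`, i.e. the block averages of the translates of `f` converge to `L`. -/
def avgTo (d : ℕ) (ω : EnvSp d) (f : EnvSp d → ℝ) (L : ℝ) : Prop :=
  Tendsto (fun n : ℕ => (∑ x ∈ box d (n : ℝ), f (shift d x ω)) / ((box d (n : ℝ)).card : ℝ))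
    atTop (𝓝 L)

/-- `ω` is averaging: `ℓ_ω(f)` exists for every continuous local `f`. -/
def Averaging (d : ℕ) (ω : EnvSp d) : Prop :=
  ∀ f : EnvSp d → ℝ, Continuous f → IsLocalFn d f → ∃ L, avgTo d ω f L

/-- `ω` is tempered, i.e. `ω ∈ Ω'`. -/
def Tempered (d : ℕ) (ω : EnvSp d) : Prop :=
  Tendsto (fun ε : ℝ =>
      limsup (fun n : ℕ =>
        (∑ e ∈ edgesIn d (box d (n : ℝ)),
            (if ε ≤ ω.1 e ∧ ω.1 e ≤ ε⁻¹ then (0:ℝ) else 1)) / (n : ℝ) ^ d) atTop)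
    (𝓝[>] 0) (𝓝 0)

/-- `P` is the measure `ℙ_ω` associated with an averaging tempered `ω`:
the unique probability measure whose expectation of every bounded continuous function
is the corresponding block-average limit `ℓ_ω(f)`. -/
def IsEnvLaw (d : ℕ) (ω : EnvSp d) (P : Measure (EnvSp d)) : Prop :=
  IsProbabilityMeasure P ∧
    ∀ f : EnvSp d → ℝ, Continuous f → IsBdd d f → avgTo d ω f (∫ ω', f ω' ∂P)

/-- Ergodicity of a measure on `Ω` with respect to the translations of `ℤ^d`. -/
def ErgodicEnv (d : ℕ) (P : Measure (EnvSp d)) : Prop :=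
  ∀ A : Set (EnvSp d), MeasurableSet A → (∀ x : Vert d, shift d x ⁻¹' A = A) →
    P A = 0 ∨ P A = 1

/-- `ω ∈ Ω⋆`: tempered, averaging, and the associated measure `ℙ_ω` is ergodic. -/
def InOmegaStar (d : ℕ) (ω : EnvSp d) : Prop :=
  Tempered d ω ∧ Averaging d ω ∧
    ∀ P : Measure (EnvSp d), IsEnvLaw d ω P → ErgodicEnv d P

/-- `ω ∈ Ω_{p,q}`. -/
def InOmegaPQ (d : ℕ) (p q : ℝ) (ω : EnvSp d) : Prop :=
  (∃ C : ℝ, ∀ n : ℕ, 1 ≤ n →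
      (∑ e ∈ edgesIn d (box d (n : ℝ)), ω.1 e ^ p) / (n : ℝ) ^ d ≤ C) ∧
  (∃ C : ℝ, ∀ n : ℕ, 1 ≤ n →
      (∑ e ∈ edgesIn d (box d (n : ℝ)), ω.1 e ^ (-q)) / (n : ℝ) ^ d ≤ C)

/-- The path space of the discrete-time walk. -/
abbrev Path (d : ℕ) := ℕ → Vert d

/-- One-step transition probabilities `𝖯_ω(x,y) = c_ω(x,y)/π_ω(x)`. -/
def transP (d : ℕ) (ω : EnvSp d) (x y : Vert d) : ℝ := cnd d ω x y / piOf d ω x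

/-- `μ` is the law `P_ω^{x₀}` of the random walk among the conductances `ω`
started at `x₀`: a probability measure on the path space with the prescribed
finite-dimensional (cylinder) probabilities. -/
def IsWalkLaw (d : ℕ) (ω : EnvSp d) (x₀ : Vert d) (μ : Measure (Path d)) : Prop :=
  IsProbabilityMeasure μ ∧
    ∀ (n : ℕ) (γ : ℕ → Vert d),
      μ {w | ∀ k ≤ n, w k = γ k} =
        (if γ 0 = x₀ then 1 else 0) *
          ∏ k ∈ Finset.range n, ENNReal.ofReal (transP d ω (γ k) (γ (k+1)))

/-- `n`-step transition probabilities of the discrete-time walk. -/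
def stepP (d : ℕ) (ω : EnvSp d) : ℕ → Vert d → Vert d → ℝ
  | 0, x, y => if x = y then 1 else 0
  | n+1, x, y => ∑ z ∈ nbrs d x, transP d ω x z * stepP d ω n z y

/-- `P_ω^x(Y_t = y)` for the constant-speed continuous-time walk `Y_t = X_{N(t)}`,
where `N` is an independent rate-1 Poisson process. -/
def ctP (d : ℕ) (ω : EnvSp d) (t : ℝ) (x y : Vert d) : ℝ :=
  ∑' k : ℕ, Real.exp (-t) * t ^ k / (Nat.factorial k : ℝ) * stepP d ω k x y

/-- The `ℓ¹`-norm of a vertex of `ℤ^d`. -/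
def l1 (d : ℕ) (x : Vert d) : ℝ := ∑ i, |(x i : ℝ)|

/-- A vertex of `ℤ^d` regarded as a point of `ℝ^d`. -/
def ivert (d : ℕ) (x : Vert d) : Fin d → ℝ := fun i => (x i : ℝ)

/-- The linearly interpolated diffusively rescaled walk `B^{(n)}`. -/
def BnProc (d : ℕ) (n : ℕ) (w : Path d) (t : ℝ) : Fin d → ℝ :=
  (Real.sqrt n)⁻¹ •
    (ivert d (w ⌊t * n⌋₊) +
      (t * n - (⌊t * n⌋₊ : ℝ)) • (ivert d (w (⌊t * n⌋₊ + 1)) - ivert d (w ⌊t * n⌋₊)))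


/-- The measure `ℚ_ω` obtained from `ℙ_ω` by tilting with `π(0)`. -/
def Qmeas (d : ℕ) (P : Measure (EnvSp d)) : Measure (EnvSp d) :=
  P.withDensity fun ω' => ENNReal.ofReal (piOf d ω' 0 / ∫ ω'', piOf d ω'' 0 ∂P)

/-- The inner product `⟨f,g⟩_{L²(πμ)}`. -/
def innerP (d : ℕ) (P : Measure (EnvSp d)) (f g : EnvSp d → ℝ) : ℝ :=
  ∫ ω', f ω' * g ω' * piOf d ω' 0 ∂P

/-- The Dirichlet pairing `⟨h, (−L)h⟩_{L²(πμ)}`. -/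
def quadL (d : ℕ) (P : Measure (EnvSp d)) (h : EnvSp d → ℝ) : ℝ :=
  ∫ ω', (∑ z ∈ nbrs d 0, cnd d ω' 0 z * (h ω' - h (shift d z ω'))) * h ω' ∂P

/-- The inner product of `L²(ν)`. -/
def innerQ (d : ℕ) (ν : Measure (EnvSp d)) (f g : EnvSp d → ℝ) : ℝ :=
  ∫ ω', f ω' * g ω' ∂ν

/-- The Dirichlet pairing `⟨h, (−L)h⟩_{L²(ν)}`. -/
def quadQ (d : ℕ) (ν : Measure (EnvSp d)) (h : EnvSp d → ℝ) : ℝ :=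
  ∫ ω', ((piOf d ω' 0)⁻¹ *
      ∑ z ∈ nbrs d 0, cnd d ω' 0 z * (h ω' - h (shift d z ω'))) * h ω' ∂ν

/-- The set whose supremum is the variational characterization
`⟨f,(−L)⁻¹f⟩_{L²(ν)} = sup_h [2⟨h,f⟩ − ⟨h,(−L)h⟩]` (over bounded continuous `h`);
`⟨f,(−L)⁻¹f⟩_{L²(ν)} < ∞` means this set is bounded above. -/
def invPairSet (d : ℕ) (ν : Measure (EnvSp d)) (f : EnvSp d → ℝ) : Set ℝ :=
  {r | ∃ h : EnvSp d → ℝ, Continuous h ∧ IsBdd d h ∧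
        r = 2 * innerQ d ν h f - quadQ d ν h}

/-- The function `f(ω) = π_ω(0)⁻¹ ∇⋆(c v)(ω)` built from a vector field `v`. -/
def fDiv (d : ℕ) (v : EnvSp d → Fin d → ℝ) (ω : EnvSp d) : ℝ :=
  (piOf d ω 0)⁻¹ *
    ∑ i, (cnd d ω 0 (unitv d i) * v ω i -
          cnd d ω (-(unitv d i)) 0 * v (shift d (-(unitv d i)) ω) i)

/-- The inner product of `ℓ²(Λ,π_ω)`. -/
def innerF (d : ℕ) (ω : EnvSp d) (Λ : Finset (Vert d)) (f g : Vert d → ℝ) : ℝ :=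
  ∑ x ∈ Λ, f x * g x * piOf d ω x

/-- The pairing `⟨h, (−𝖫_ω)h⟩_{ℓ²(Λ,π_ω)}` for `h` vanishing outside `Λ`. -/
def quadF (d : ℕ) (ω : EnvSp d) (Λ : Finset (Vert d)) (h : Vert d → ℝ) : ℝ :=
  ∑ x ∈ Λ, (∑ z ∈ nbrs d x, cnd d ω x z * (h x - h z)) * h x

/-- `⟨f, (−𝖫_ω)⁻¹_Λ f⟩_{ℓ²(Λ,π_ω)}` via its variational characterization
`sup_h [2⟨h,f⟩ − ⟨h,(−𝖫_ω)h⟩]` over `h ∈ ℓ²(Λ,π_ω)`. -/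
def invPairF (d : ℕ) (ω : EnvSp d) (Λ : Finset (Vert d)) (f : Vert d → ℝ) : ℝ :=
  sSup {r | ∃ h : Vert d → ℝ, (∀ x ∉ Λ, h x = 0) ∧
      r = 2 * innerF d ω Λ h f - quadF d ω Λ h}

/-- The antisymmetric edge function `v∘τ(ω)`: the value assigned to the
edge `(x, x+e_i)` is `v_i(τ_x(ω))`. -/
def efield (d : ℕ) (v : EnvSp d → Fin d → ℝ) (ω : EnvSp d) : Vert d → Fin d → ℝ :=
  fun x i => v (shift d x ω) i

/-- The discrete gradient `∇h` of `h : ℤ^d → ℝ` as an edge function. -/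
def dgradE (d : ℕ) (h : Vert d → ℝ) : Vert d → Fin d → ℝ :=
  fun x i => h (x + unitv d i) - h x

/-- The inner product `⟨u,w⟩_{ℓ²(E(Λ), c_ω)}` of (antisymmetric) edge functions;
each unordered edge is counted once, which agrees with the paper's sum over
ordered edges carrying the factor ½. -/
def einner (d : ℕ) (ω : EnvSp d) (Λ : Finset (Vert d)) (u w : Vert d → Fin d → ℝ) : ℝ :=
  ∑ e ∈ edgesIn d Λ, u e.1 e.2 * w e.1 e.2 * ω.1 e

/-- The Dirichlet energy `𝓔_Λ^ω(v)`. -/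
def direnergy (d : ℕ) (ω : EnvSp d) (Λ : Finset (Vert d)) (v : EnvSp d → Fin d → ℝ) : ℝ :=
  sInf {r | ∃ h : Vert d → ℝ, (∀ x ∉ Λ, h x = 0) ∧
      r = einner d ω Λ (fun x i => efield d v ω x i - dgradE d h x i)
            (fun x i => efield d v ω x i - dgradE d h x i)}

/-- The gradient `∇h` of a function on `Ω`. -/
def gradOmega (d : ℕ) (h : EnvSp d → ℝ) : EnvSp d → Fin d → ℝ :=
  fun ω i => h (shift d (unitv d i) ω) - h ω

/-- The inner product `⟨u, c w⟩_{L²(P,ℝ^d)}`. -/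
def cinnerP (d : ℕ) (P : Measure (EnvSp d)) (u w : EnvSp d → Fin d → ℝ) : ℝ :=
  ∑ i, ∫ ω', cnd d ω' 0 (unitv d i) * u ω' i * w ω' i ∂P

/-- Bounded vector fields on `Ω`. -/
def IsBddV (d : ℕ) (v : EnvSp d → Fin d → ℝ) : Prop := ∃ M, ∀ ω i, |v ω i| ≤ M

/-- The space `𝒱 = (ℝ^d)^{ℤ^d}` of vector fields on `ℤ^d`. -/
abbrev VS (d : ℕ) := Vert d → Fin d → ℝ

/-- The empirical measures `μ_r^{ω,v}` built from the minimizers `h_r` of the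
finite-volume Dirichlet energies. -/
def muR (d : ℕ) (ω : EnvSp d) (hr : ℕ → Vert d → ℝ) (r : ℕ) :
    Measure (EnvSp d × VS d) :=
  (((box d ((r : ℝ) + Real.sqrt r)).card : ℝ≥0∞) *
      ((box d (Real.sqrt r)).card : ℝ≥0∞))⁻¹ •
    ∑ z ∈ box d (Real.sqrt r), ∑ x ∈ box d ((r : ℝ) + Real.sqrt r),
      Measure.dirac (shift d (x + z) ω, fun y => dgradE d (hr r) (x + z + y))

/-- The localized conductances `c_ω^R`. -/
def cR (d : ℕ) (ω : EnvSp d) (R : ℝ) (e : EdgeIx d) : ℝ :=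
  if e ∈ edgesIn d (box d (2 * R)) then ω.1 e else 1

/-- The localized measure `π_ω^R`. -/
def piRloc (d : ℕ) (ω : EnvSp d) (R : ℝ) (x : Vert d) : ℝ :=
  if x ∈ box d (2 * R) then piOf d ω x
  else if x ∈ box d (4 * R) then 1 + piOf d ω x else 1

/-- The localized Dirichlet form `D_ω^R(f,f)` (each unordered edge counted once). -/
def DR (d : ℕ) (ω : EnvSp d) (R : ℝ) (f : Vert d → ℝ) : ℝ≥0∞ :=
  ∑' e : EdgeIx d, ENNReal.ofReal (cR d ω R e * (f (e.1 + unitv d e.2) - f e.1) ^ 2)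

/-- The norm `‖f‖_{ℓ^s(μ)}`. -/
def lpN (d : ℕ) (μw : Vert d → ℝ) (s : ℝ) (f : Vert d → ℝ) : ℝ≥0∞ :=
  (∑' x : Vert d, ENNReal.ofReal (|f x| ^ s * μw x)) ^ (1 / s)

/-- The exponent `ε = 2(2/d − 1/p − 1/q)((d−2)/d + 1/q)⁻¹`. -/
def epsPQ (d : ℕ) (p q : ℝ) : ℝ :=
  2 * (2 / (d : ℝ) - 1 / p - 1 / q) / (((d : ℝ) - 2) / (d : ℝ) + 1 / q)

/-- Jump rates of the localized constant-speed chain `Y^R`: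
rate `c_ω^R(x,y)/π_ω^R(x)` from `x` to `y`. -/
def rateR (d : ℕ) (ω : EnvSp d) (R : ℝ) (x y : Vert d) : ℝ :=
  (∑ i, ((if y = x + unitv d i then cR d ω R (x, i) else 0) +
         (if x = y + unitv d i then cR d ω R (y, i) else 0))) / piRloc d ω R x

/-- The generator matrix of `Y^R`. -/
def qmatR (d : ℕ) (ω : EnvSp d) (R : ℝ) (x y : Vert d) : ℝ :=
  if x = y then -(∑ z ∈ nbrs d x, rateR d ω R x z) else rateR d ω R x y

/-- Iterates of the generator matrix of `Y^R`. -/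
def qiter (d : ℕ) (ω : EnvSp d) (R : ℝ) : ℕ → Vert d → Vert d → ℝ
  | 0, x, y => if x = y then 1 else 0
  | n+1, x, y => ∑ z ∈ insert x (nbrs d x), qmatR d ω R x z * qiter d ω R n z y

/-- The heat kernel `P_ω^x(Y_t^R = y) = (e^{tQ})(x,y)` of the localized chain `Y^R`. -/
def hkR (d : ℕ) (ω : EnvSp d) (R : ℝ) (t : ℝ) (x y : Vert d) : ℝ :=
  ∑' k : ℕ, t ^ k / (Nat.factorial k : ℝ) * qiter d ω R k x y

section ExitTimes

variable {d : ℕ}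

lemma mem_edgesIn {A : Finset (Vert d)} {e : EdgeIx d} :
    e ∈ edgesIn d A ↔ e.1 ∈ A ∨ e.1 + unitv d e.2 ∈ A := by
  obtain ⟨x, i⟩ := e
  simp only [edgesIn, Finset.mem_biUnion, Finset.mem_union, Finset.mem_image, Finset.mem_univ,
    true_and, Prod.mk.injEq]
  constructor
  · rintro ⟨y, hy, ⟨j, rfl, rfl⟩ | ⟨j, rfl, rfl⟩⟩
    · exact Or.inl hy
    · right; simpa using hy
  · rintro (h | h)
    · exact ⟨x, h, Or.inl ⟨i, rfl, rfl⟩⟩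
    · exact ⟨_, h, Or.inr ⟨i, by simp, rfl⟩⟩

lemma edgesIn_mono {A B : Finset (Vert d)} (h : A ⊆ B) : edgesIn d A ⊆ edgesIn d B := by
  intro e he
  rw [mem_edgesIn] at he ⊢
  exact he.imp (fun h' => h h') (fun h' => h h')

lemma sum_edgesIn_fst (A : Finset (Vert d)) (F : EdgeIx d → ℝ) (g : Vert d → ℝ)
    (hg : ∀ x ∉ A, g x = 0) :
    ∑ e ∈ edgesIn d A, F e * g e.1 = ∑ x ∈ A, ∑ i, F (x, i) * g x := by
  rw [← Finset.sum_product' A Finset.univ (fun x i => F (x, i) * g x)]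
  symm
  refine Finset.sum_subset (fun e he => ?_) (fun e _ he => ?_)
  · rw [mem_edgesIn]; left; simpa using he
  · rw [hg, mul_zero]; simpa using he

lemma sum_edgesIn_snd (A : Finset (Vert d)) (F : EdgeIx d → ℝ) (g : Vert d → ℝ)
    (hg : ∀ x ∉ A, g x = 0) :
    ∑ e ∈ edgesIn d A, F e * g (e.1 + unitv d e.2) =
      ∑ x ∈ A, ∑ i, F (x - unitv d i, i) * g x := by
  rw [← Finset.sum_product' A Finset.univ (fun x i => F (x - unitv d i, i) * g x)]
  have hinj : Function.Injective (fun e : EdgeIx d => ((e.1 - unitv d e.2, e.2) : EdgeIx d)) := by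
    rintro ⟨x, i⟩ ⟨y, j⟩ h
    simp only [Prod.mk.injEq] at h
    obtain ⟨h1, rfl⟩ := h
    simpa using h1
  symm
  refine Eq.trans ?_ (Finset.sum_subset
    (s₁ := (A ×ˢ Finset.univ).image fun e : EdgeIx d => ((e.1 - unitv d e.2, e.2) : EdgeIx d))
    (fun e he => ?_) (fun e _ he => ?_))
  · rw [Finset.sum_image hinj.injOn]; simp
  · rw [mem_edgesIn]; right
    obtain ⟨a, ha, rfl⟩ := Finset.mem_image.1 he
    simpa using ha
  · rw [hg, mul_zero]
    intro h
    exact he (Finset.mem_image.2 ⟨(e.1 + unitv d e.2, e.2), by simpa using h, by simp⟩)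

/-- The generator applied to `f`, multiplied by `π_ω`. -/
def lapl (d : ℕ) (ω : EnvSp d) (f : Vert d → ℝ) (x : Vert d) : ℝ :=
  ∑ i, (ω.1 (x, i) * (f (x + unitv d i) - f x) +
    ω.1 (x - unitv d i, i) * (f (x - unitv d i) - f x))

lemma sum_mul_lapl (ω : EnvSp d) (A : Finset (Vert d)) (f g : Vert d → ℝ)
    (hg : ∀ x ∉ A, g x = 0) :
    ∑ x ∈ A, g x * lapl d ω f x =
      -∑ e ∈ edgesIn d A, ω.1 e * (dgradE d f e.1 e.2 * dgradE d g e.1 e.2) := by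
  have h1 := sum_edgesIn_fst A (fun e => ω.1 e * dgradE d f e.1 e.2) g hg
  have h2 := sum_edgesIn_snd A (fun e => ω.1 e * dgradE d f e.1 e.2) g hg
  have h3 : ∑ e ∈ edgesIn d A, ω.1 e * (dgradE d f e.1 e.2 * dgradE d g e.1 e.2) =
      ∑ e ∈ edgesIn d A, ω.1 e * dgradE d f e.1 e.2 * g (e.1 + unitv d e.2) -
      ∑ e ∈ edgesIn d A, ω.1 e * dgradE d f e.1 e.2 * g e.1 := by
    rw [← Finset.sum_sub_distrib]
    refine Finset.sum_congr rfl fun e _ => ?_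
    simp only [dgradE]; ring
  rw [h3, h1, h2, neg_sub, ← Finset.sum_sub_distrib]
  refine Finset.sum_congr rfl fun x _ => ?_
  rw [← Finset.sum_sub_distrib, lapl, Finset.mul_sum]
  refine Finset.sum_congr rfl fun i _ => ?_
  simp only [dgradE, sub_add_cancel]; ring

/-- Energy estimate for the truncations `(u - ψ - k)₊` of a function solving the killed
equation in `B`, where the barrier `ψ` dominates `u` outside `B`. -/
lemma energy_le (ω : EnvSp d) (B : Finset (Vert d)) (κ r : ℝ)
    (u ψ : Vert d → ℝ)
    (hu : ∀ x ∈ B, lapl d ω u x = κ * piOf d ω x * u x)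
    (hψ : ∀ x i, |ψ (x + unitv d i) - ψ x| ≤ r⁻¹) (k : ℝ)
    (A : Finset (Vert d)) (hAB : A ⊆ B) (hA : ∀ x, x ∈ A ↔ k < u x - ψ x)
    (w : Vert d → ℝ) (hw : ∀ x, w x = max (u x - ψ x - k) 0) :
    2 * κ * ∑ x ∈ A, piOf d ω x * u x * w x +
      ∑ e ∈ edgesIn d A, ω.1 e * dgradE d w e.1 e.2 ^ 2 ≤
      r⁻¹ ^ 2 * ∑ e ∈ edgesIn d A, ω.1 e := by
  have hw0 : ∀ x ∉ A, w x = 0 := fun x hx => by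
    rw [hA, not_lt] at hx
    rw [hw]; exact max_eq_right (by linarith)
  have h1 := sum_mul_lapl ω A u w hw0
  have h2 : ∑ x ∈ A, w x * lapl d ω u x = κ * ∑ x ∈ A, piOf d ω x * u x * w x := by
    rw [Finset.mul_sum]
    refine Finset.sum_congr rfl fun x hx => ?_
    rw [hu x (hAB hx)]; ring
  have h3 : ∑ e ∈ edgesIn d A, ω.1 e * dgradE d w e.1 e.2 ^ 2 ≤
      ∑ e ∈ edgesIn d A, (2 * (ω.1 e * (dgradE d u e.1 e.2 * dgradE d w e.1 e.2)) +
        r⁻¹ ^ 2 * ω.1 e) := by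
    refine Finset.sum_le_sum fun e _ => ?_
    have hω := ω.2 e
    have key : dgradE d w e.1 e.2 ^ 2 ≤ 2 * (dgradE d u e.1 e.2 * dgradE d w e.1 e.2) + r⁻¹ ^ 2 := by
      have hb := hψ e.1 e.2
      simp only [dgradE, hw]
      generalize u (e.1 + unitv d e.2) = a at *
      generalize u e.1 = b at *
      generalize ψ (e.1 + unitv d e.2) = a' at *
      generalize ψ e.1 = b' at *
      have hs : (a' - b') ^ 2 ≤ r⁻¹ ^ 2 := sq_le_sq' (by linarith [abs_le.1 hb]) (abs_le.1 hb).2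
      set W := max (a - a' - k) 0 - max (b - b' - k) 0 with hW
      have hmon : W ^ 2 ≤ ((a - a') - (b - b')) * W := by
        rw [hW]
        rcases le_total (a - a' - k) 0 with h | h <;> rcases le_total (b - b' - k) 0 with h' | h' <;>
          simp only [h, h', max_eq_left, max_eq_right] <;> nlinarith
      nlinarith [sq_nonneg (W + (a' - b'))]
    nlinarith
  rw [Finset.sum_add_distrib, ← Finset.mul_sum, ← Finset.mul_sum] at h3
  linarith

lemma piOf_pos (hd : 0 < d) (ω : EnvSp d) (x : Vert d) : 0 < piOf d ω x :=
  Finset.sum_pos (fun _ _ => add_pos (ω.2 _) (ω.2 _)) ⟨⟨0, hd⟩, Finset.mem_univ _⟩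

/-- The transition operator of the walk. -/
def avgOp (d : ℕ) (ω : EnvSp d) (f : Vert d → ℝ) (x : Vert d) : ℝ :=
  (∑ i, (ω.1 (x, i) * f (x + unitv d i) + ω.1 (x - unitv d i, i) * f (x - unitv d i))) /
    piOf d ω x

lemma avgOp_mono (hd : 0 < d) (ω : EnvSp d) {f g : Vert d → ℝ} {x : Vert d}
    (h : ∀ i, f (x + unitv d i) ≤ g (x + unitv d i))
    (h' : ∀ i, f (x - unitv d i) ≤ g (x - unitv d i)) : avgOp d ω f x ≤ avgOp d ω g x := by
  unfold avgOp
  refine div_le_div_of_nonneg_right (Finset.sum_le_sum fun i _ => add_le_add ?_ ?_)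
    (piOf_pos hd ω x).le
  · exact mul_le_mul_of_nonneg_left (h i) (ω.2 _).le
  · exact mul_le_mul_of_nonneg_left (h' i) (ω.2 _).le

lemma avgOp_const (hd : 0 < d) (ω : EnvSp d) (a : ℝ) (x : Vert d) :
    avgOp d ω (fun _ => a) x = a := by
  unfold avgOp
  simp only [← add_mul, ← Finset.sum_mul]
  exact mul_div_cancel_left₀ _ (piOf_pos hd ω x).ne'

lemma avgOp_const_mul (ω : EnvSp d) (a : ℝ) (f : Vert d → ℝ) (x : Vert d) :
    avgOp d ω (fun y => a * f y) x = a * avgOp d ω f x := by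
  unfold avgOp
  rw [← mul_div_assoc, Finset.mul_sum]
  congr 1
  exact Finset.sum_congr rfl fun i _ => by ring

lemma avgOp_one_sub (hd : 0 < d) (ω : EnvSp d) (f : Vert d → ℝ) (x : Vert d) :
    avgOp d ω (fun y => 1 - f y) x = 1 - avgOp d ω f x := by
  have h := avgOp_const hd ω 1 x
  refine eq_sub_of_add_eq (Eq.trans ?_ h)
  unfold avgOp
  rw [← add_div, ← Finset.sum_add_distrib]
  congr 1
  exact Finset.sum_congr rfl fun i _ => by ring

lemma lapl_eq (hd : 0 < d) (ω : EnvSp d) (f : Vert d → ℝ) (x : Vert d) :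
    lapl d ω f x = piOf d ω x * (avgOp d ω f x - f x) := by
  unfold avgOp
  rw [mul_sub, mul_div_cancel₀ _ (piOf_pos hd ω x).ne', lapl, piOf, Finset.sum_mul,
    ← Finset.sum_sub_distrib]
  exact Finset.sum_congr rfl fun i _ => by ring

lemma sum_transP_mul (ω : EnvSp d) (B : Finset (Vert d)) (g : Vert d → ℝ)
    (hg : ∀ x ∉ B, g x = 0) (x : Vert d) :
    ∑ z ∈ B, transP d ω x z * g z = avgOp d ω g x := by
  simp only [transP, div_mul_eq_mul_div, avgOp]
  rw [← Finset.sum_div]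
  congr 1
  simp only [cnd, Finset.sum_mul]
  rw [Finset.sum_comm]
  refine Finset.sum_congr rfl fun i _ => ?_
  simp only [add_mul, ite_mul, zero_mul]
  rw [Finset.sum_add_distrib, Finset.sum_ite_eq']
  have : ∀ z : Vert d, x = z + unitv d i ↔ z = x - unitv d i := fun z =>
    ⟨fun h => by simp [h], fun h => by simp [h]⟩
  simp only [this]
  rw [Finset.sum_ite_eq']
  congr 1
  · split_ifs with h
    · rfl
    · rw [hg _ h, mul_zero]
  · split_ifs with h
    · rfl
    · rw [hg _ h, mul_zero]

/-- The probability that the walk leaves `B` within `n` steps. -/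
def exitP (d : ℕ) (ω : EnvSp d) (B : Finset (Vert d)) : ℕ → Vert d → ℝ
  | 0, x => if x ∈ B then 0 else 1
  | n + 1, x => if x ∈ B then avgOp d ω (exitP d ω B n) x else 1

lemma exitP_of_notMem (ω : EnvSp d) {B : Finset (Vert d)} {x : Vert d} (hx : x ∉ B) (n : ℕ) :
    exitP d ω B n x = 1 := by
  cases n <;> simp [exitP, hx]

lemma exitP_succ (ω : EnvSp d) {B : Finset (Vert d)} {x : Vert d} (hx : x ∈ B) (n : ℕ) :
    exitP d ω B (n + 1) x = avgOp d ω (exitP d ω B n) x := by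
  simp [exitP, hx]

lemma exitP_nonneg (hd : 0 < d) (ω : EnvSp d) (B : Finset (Vert d)) (n : ℕ) (x : Vert d) :
    0 ≤ exitP d ω B n x := by
  induction n generalizing x with
  | zero => unfold exitP; split_ifs <;> norm_num
  | succ n ih =>
    by_cases hx : x ∈ B
    · rw [exitP_succ ω hx, ← avgOp_const hd ω 0 x]
      exact avgOp_mono hd ω (fun i => ih _) (fun i => ih _)
    · rw [exitP_of_notMem ω hx]; norm_num

lemma exitP_le_one (hd : 0 < d) (ω : EnvSp d) (B : Finset (Vert d)) (n : ℕ) (x : Vert d) :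
    exitP d ω B n x ≤ 1 := by
  induction n generalizing x with
  | zero => unfold exitP; split_ifs <;> norm_num
  | succ n ih =>
    by_cases hx : x ∈ B
    · rw [exitP_succ ω hx, ← avgOp_const hd ω 1 x]
      exact avgOp_mono hd ω (fun i => ih _) (fun i => ih _)
    · rw [exitP_of_notMem ω hx]

lemma exitP_le_succ (hd : 0 < d) (ω : EnvSp d) (B : Finset (Vert d)) (n : ℕ) (x : Vert d) :
    exitP d ω B n x ≤ exitP d ω B (n + 1) x := by
  induction n generalizing x with
  | zero =>
    by_cases hx : x ∈ B
    · simpa [exitP, hx] using exitP_nonneg hd ω B 1 x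
    · rw [exitP_of_notMem ω hx, exitP_of_notMem ω hx]
  | succ n ih =>
    by_cases hx : x ∈ B
    · rw [exitP_succ ω hx, exitP_succ ω hx]
      exact avgOp_mono hd ω (fun i => ih _) (fun i => ih _)
    · rw [exitP_of_notMem ω hx, exitP_of_notMem ω hx]

lemma exitP_mono (hd : 0 < d) (ω : EnvSp d) (B : Finset (Vert d)) (x : Vert d) :
    Monotone fun n => exitP d ω B n x :=
  monotone_nat_of_le_succ fun n => exitP_le_succ hd ω B n x

lemma exitP_anti (hd : 0 < d) (ω : EnvSp d) {B D : Finset (Vert d)} (h : B ⊆ D) (n : ℕ)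
    (x : Vert d) : exitP d ω D n x ≤ exitP d ω B n x := by
  induction n generalizing x with
  | zero =>
    by_cases hx : x ∈ B
    · simp [exitP, hx, h hx]
    · rw [exitP_of_notMem ω hx]; exact exitP_le_one hd ω D _ x
  | succ n ih =>
    by_cases hx : x ∈ B
    · rw [exitP_succ ω hx, exitP_succ ω (h hx)]
      exact avgOp_mono hd ω (fun i => ih _) (fun i => ih _)
    · rw [exitP_of_notMem ω hx]; exact exitP_le_one hd ω D _ x

/-- The strong Markov property at the exit time of `B`, as an inequality. -/
lemma exitP_le_mul (hd : 0 < d) (ω : EnvSp d) {B D : Finset (Vert d)} (h : B ⊆ D) (N : ℕ)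
    (b : ℝ)
    (h1 : ∀ y ∈ B, ∀ i, y + unitv d i ∉ B → exitP d ω D N (y + unitv d i) ≤ b)
    (h2 : ∀ y ∈ B, ∀ i, y - unitv d i ∉ B → exitP d ω D N (y - unitv d i) ≤ b)
    (n : ℕ) (hn : n ≤ N) (x : Vert d) (hx : x ∈ B) :
    exitP d ω D n x ≤ b * exitP d ω B n x := by
  induction n generalizing x with
  | zero => simp [exitP, hx, h hx]
  | succ n ih =>
    rw [exitP_succ ω hx, exitP_succ ω (h hx), ← avgOp_const_mul]
    refine avgOp_mono hd ω (fun i => ?_) (fun i => ?_)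
    · by_cases hz : x + unitv d i ∈ B
      · exact ih (by omega) _ hz
      · rw [exitP_of_notMem ω hz, mul_one]
        exact (exitP_mono hd ω D _ (by omega)).trans (h1 x hx i hz)
    · by_cases hz : x - unitv d i ∈ B
      · exact ih (by omega) _ hz
      · rw [exitP_of_notMem ω hz, mul_one]
        exact (exitP_mono hd ω D _ (by omega)).trans (h2 x hx i hz)

lemma transP_nonneg (hd : 0 < d) (ω : EnvSp d) (x y : Vert d) : 0 ≤ transP d ω x y := by
  refine div_nonneg (Finset.sum_nonneg fun i _ => add_nonneg ?_ ?_) (piOf_pos hd ω x).le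
  · split_ifs
    exacts [(ω.2 _).le, le_rfl]
  · split_ifs
    exacts [(ω.2 _).le, le_rfl]

lemma measurableSet_path (s : ℕ → Set (Vert d)) (p : ℕ → Prop) :
    MeasurableSet {w : Path d | ∀ k, p k → w k ∈ s k} := by
  simp only [Set.ofPred_forall]
  exact MeasurableSet.iInter fun k => MeasurableSet.iInter fun _ =>
    (measurable_pi_apply k) (MeasurableSet.of_discrete)

lemma walk_stay (hd : 0 < d) (ω : EnvSp d) {x₀ : Vert d} {μ : Measure (Path d)}
    (hμ : IsWalkLaw d ω x₀ μ) (B : Finset (Vert d)) (n m : ℕ) (γ : ℕ → Vert d) :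
    μ {w | (∀ k ≤ m, w k = γ k) ∧ ∀ k, m ≤ k ∧ k ≤ m + n → w k ∈ B} =
      μ {w | ∀ k ≤ m, w k = γ k} * ENNReal.ofReal (1 - exitP d ω B n (γ m)) := by
  induction n generalizing m γ with
  | zero =>
    by_cases hx : γ m ∈ B
    · simp only [exitP, hx, if_true, sub_zero, ENNReal.ofReal_one, mul_one]
      congr 1
      ext w
      simp only [Set.mem_ofPred_eq, and_iff_left_iff_imp]
      intro h k hk
      obtain rfl : k = m := by omega
      rw [h k le_rfl]; exact hx
    · rw [exitP_of_notMem ω hx, sub_self, ENNReal.ofReal_zero, mul_zero]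
      convert measure_empty (μ := μ)
      ext w
      simp only [Set.mem_ofPred_eq, Set.mem_empty_iff_false, iff_false, not_and, not_forall]
      intro h
      refine ⟨m, by omega, ?_⟩
      rw [h m le_rfl]; exact hx
  | succ n ih =>
    by_cases hx : γ m ∈ B
    · have hset : {w : Path d | (∀ k ≤ m, w k = γ k) ∧ ∀ k, m ≤ k ∧ k ≤ m + (n + 1) → w k ∈ B} =
          ⋃ z ∈ B, {w : Path d | (∀ k ≤ m + 1, w k = Function.update γ (m + 1) z k) ∧
            ∀ k, m + 1 ≤ k ∧ k ≤ m + 1 + n → w k ∈ B} := by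
        ext w
        simp only [Set.mem_ofPred_eq, Set.mem_iUnion, exists_prop]
        constructor
        · rintro ⟨h1, h2⟩
          refine ⟨w (m + 1), h2 _ (by omega), fun k hk => ?_, fun k hk => h2 k (by omega)⟩
          by_cases hk' : k = m + 1
          · subst hk'; simp
          · rw [Function.update_of_ne hk']; exact h1 k (by omega)
        · rintro ⟨z, hz, h1, h2⟩
          have h3 : ∀ k ≤ m, w k = γ k := fun k hk => by
            rw [h1 k (by omega), Function.update_of_ne (by omega)]
          refine ⟨h3, fun k hk => ?_⟩
          by_cases hk' : k = m
          · rw [hk', h3 m le_rfl]; exact hx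
          · exact h2 k (by omega)
      rw [hset, measure_biUnion_finset]
      · have hcyl : ∀ z : Vert d,
            μ {w | ∀ k ≤ m + 1, w k = Function.update γ (m + 1) z k} =
              μ {w | ∀ k ≤ m, w k = γ k} * ENNReal.ofReal (transP d ω (γ m) z) := by
          intro z
          have hprod : ∏ k ∈ Finset.range m, ENNReal.ofReal (transP d ω
              (Function.update γ (m + 1) z k) (Function.update γ (m + 1) z (k + 1))) =
              ∏ k ∈ Finset.range m, ENNReal.ofReal (transP d ω (γ k) (γ (k + 1))) := by
            refine Finset.prod_congr rfl fun k hk => ?_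
            have := Finset.mem_range.1 hk
            rw [Function.update_of_ne (by omega), Function.update_of_ne (by omega)]
          rw [hμ.2, hμ.2, Finset.prod_range_succ, hprod, Function.update_self,
            Function.update_of_ne (by omega), Function.update_of_ne (by omega), mul_assoc]
        simp only [ih, hcyl, Function.update_self, mul_assoc]
        rw [← Finset.mul_sum]
        congr 1
        rw [exitP_succ ω hx, ← avgOp_one_sub hd, ← sum_transP_mul ω B,
          ENNReal.ofReal_sum_of_nonneg]
        · exact Finset.sum_congr rfl fun z _ => (ENNReal.ofReal_mul (transP_nonneg hd ω _ _)).symm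
        · exact fun z _ => mul_nonneg (transP_nonneg hd ω _ _)
            (sub_nonneg.2 (exitP_le_one hd ω B n z))
        · intro z hz; rw [exitP_of_notMem ω hz, sub_self]
      · intro z _ z' _ hzz'
        refine Set.disjoint_left.2 fun w hw hw' => hzz' ?_
        have h1 := hw.1 (m + 1) le_rfl
        have h2 := hw'.1 (m + 1) le_rfl
        simp only [Function.update_self] at h1 h2
        exact h1.symm.trans h2
      · intro z _
        exact (measurableSet_path (fun k => {Function.update γ (m + 1) z k}) (· ≤ m + 1)).inter
          (measurableSet_path (fun _ => (B : Set (Vert d))) fun k => m + 1 ≤ k ∧ k ≤ m + 1 + n)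
    · rw [exitP_of_notMem ω hx, sub_self, ENNReal.ofReal_zero, mul_zero]
      convert measure_empty (μ := μ)
      ext w
      simp only [Set.mem_ofPred_eq, Set.mem_empty_iff_false, iff_false, not_and, not_forall]
      intro h
      refine ⟨m, by omega, ?_⟩
      rw [h m le_rfl]; exact hx

lemma walk_exit_le (hd : 0 < d) (ω : EnvSp d) {x₀ : Vert d} {μ : Measure (Path d)}
    (hμ : IsWalkLaw d ω x₀ μ) (B : Finset (Vert d)) (n : ℕ) :
    μ {w | ∃ k ≤ n, w k ∉ B} ≤ ENNReal.ofReal (exitP d ω B n x₀) := by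
  have := hμ.1
  have h := walk_stay hd ω hμ B n 0 (fun _ => x₀)
  rw [hμ.2] at h
  simp only [if_true, Finset.range_zero, Finset.prod_empty, mul_one, one_mul] at h
  set S := {w : Path d | (∀ k ≤ 0, w k = x₀) ∧ ∀ k, 0 ≤ k ∧ k ≤ 0 + n → w k ∈ B} with hS
  have hSm : MeasurableSet S := (measurableSet_path (fun _ => {x₀}) (· ≤ 0)).inter
    (measurableSet_path (fun _ => (B : Set (Vert d))) fun k => 0 ≤ k ∧ k ≤ 0 + n)
  have hsub : {w : Path d | ∃ k ≤ n, w k ∉ B} ⊆ Sᶜ := by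
    rintro w ⟨k, hk, hw⟩ h'
    exact hw (h'.2 k (by omega))
  refine (measure_mono hsub).trans ?_
  rw [prob_compl_eq_one_sub hSm, h, ← ENNReal.ofReal_one, ← ENNReal.ofReal_sub _
    (sub_nonneg.2 (exitP_le_one hd ω B n x₀))]
  simp

/-- The exit probabilities are dominated by a bounded solution of the killed equation, namely
the Laplace transform of the exit time. -/
lemma exists_killed_solution (hd : 0 < d) (ω : EnvSp d) (B : Finset (Vert d)) (n : ℕ)
    (hn : 0 < n) :
    ∃ u : Vert d → ℝ, (∀ x, 0 ≤ u x) ∧ (∀ x, u x ≤ 1) ∧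
      (∀ x ∈ B, lapl d ω u x = (n : ℝ)⁻¹ * piOf d ω x * u x) ∧
      ∀ x, exitP d ω B n x ≤ Real.exp 1 * u x := by
  have hn' : (0 : ℝ) < n := by exact_mod_cast hn
  obtain ⟨θ, hθ⟩ : ∃ θ : ℝ, θ = n / (n + 1) := ⟨_, rfl⟩
  have hθ0 : 0 < θ := by rw [hθ]; positivity
  have hθ1 : θ < 1 := by rw [hθ, div_lt_one (by positivity)]; linarith
  have hgeo : HasSum (fun k : ℕ => (1 - θ) * θ ^ k) 1 := by
    have := (hasSum_geometric_of_lt_one hθ0.le hθ1).mul_left (1 - θ)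
    rwa [mul_inv_cancel₀ (by linarith)] at this
  have hterm0 : ∀ x k, 0 ≤ (1 - θ) * θ ^ k * exitP d ω B k x := fun x k =>
    mul_nonneg (mul_nonneg (by linarith) (by positivity)) (exitP_nonneg hd ω B k x)
  have hterm1 : ∀ x k, (1 - θ) * θ ^ k * exitP d ω B k x ≤ (1 - θ) * θ ^ k := fun x k =>
    mul_le_of_le_one_right (mul_nonneg (by linarith) (by positivity)) (exitP_le_one hd ω B k x)
  have hsum : ∀ x, Summable fun k => (1 - θ) * θ ^ k * exitP d ω B k x := fun x =>
    Summable.of_nonneg_of_le (hterm0 x) (hterm1 x) hgeo.summable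
  obtain ⟨u, hu⟩ : ∃ u : Vert d → ℝ,
      ∀ x, HasSum (fun k => (1 - θ) * θ ^ k * exitP d ω B k x) (u x) :=
    ⟨_, fun x => (hsum x).hasSum⟩
  refine ⟨u, fun x => (hu x).nonneg (hterm0 x), fun x => hasSum_le (hterm1 x) (hu x) hgeo,
    fun x hx => ?_, fun x => ?_⟩
  · have h1 : HasSum (fun k => (1 - θ) * θ ^ (k + 1) * exitP d ω B (k + 1) x)
        (θ * avgOp d ω u x) := by
      have h2 : HasSum (fun k => avgOp d ω (fun y => (1 - θ) * θ ^ k * exitP d ω B k y) x)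
          (avgOp d ω u x) := by
        unfold avgOp
        exact (hasSum_sum fun i _ => ((hu _).mul_left _).add ((hu _).mul_left _)).div_const _
      convert! h2.mul_left θ using 2 with k
      rw [exitP_succ ω hx, avgOp_const_mul]; ring
    have h2 : u x = θ * avgOp d ω u x := by
      refine (hu x).unique ?_
      have := (hasSum_nat_add_iff (f := fun k => (1 - θ) * θ ^ k * exitP d ω B k x) 1).1 h1
      simpa [exitP, hx] using this
    rw [lapl_eq hd, mul_comm (n : ℝ)⁻¹, mul_assoc]
    congr 1
    rw [hθ] at h2
    field_simp at h2 ⊢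
    linarith
  · have h1 : θ ^ n * exitP d ω B n x ≤ u x := by
      have h2 := (hu x).summable.sum_add_tsum_nat_add n
      rw [(hu x).tsum_eq] at h2
      have h3 : θ ^ n * exitP d ω B n x ≤
          ∑' k, (1 - θ) * θ ^ (k + n) * exitP d ω B (k + n) x := by
        have h4 : HasSum (fun k => (1 - θ) * θ ^ (k + n) * exitP d ω B n x)
            (θ ^ n * exitP d ω B n x) := by
          have h := hgeo.mul_left (θ ^ n * exitP d ω B n x)
          rw [mul_one] at h
          convert! h using 2
          ring
        refine hasSum_le (fun k => ?_) h4 ((summable_nat_add_iff n).2 (hsum x)).hasSum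
        exact mul_le_mul_of_nonneg_left (exitP_mono hd ω B x (Nat.le_add_left n k))
          (mul_nonneg (by linarith) (by positivity))
      have h5 := Finset.sum_nonneg fun k (_ : k ∈ Finset.range n) => hterm0 x k
      linarith
    have h6 : 1 ≤ Real.exp 1 * θ ^ n := by
      have h7 : θ⁻¹ ^ n ≤ Real.exp 1 := by
        have : θ⁻¹ ≤ Real.exp (n : ℝ)⁻¹ := by
          refine le_trans (le_of_eq ?_) (Real.add_one_le_exp _)
          rw [hθ]; field_simp; ring
        calc θ⁻¹ ^ n ≤ Real.exp (n : ℝ)⁻¹ ^ n := pow_le_pow_left₀ (by positivity) this n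
          _ = Real.exp 1 := by rw [← Real.exp_nat_mul, mul_inv_cancel₀ hn'.ne']
      calc (1 : ℝ) = θ⁻¹ ^ n * θ ^ n := by rw [← mul_pow, inv_mul_cancel₀ hθ0.ne', one_pow]
        _ ≤ _ := mul_le_mul_of_nonneg_right h7 (by positivity)
    calc exitP d ω B n x ≤ Real.exp 1 * θ ^ n * exitP d ω B n x :=
          le_mul_of_one_le_left (exitP_nonneg hd ω B n x) h6
      _ = Real.exp 1 * (θ ^ n * exitP d ω B n x) := by ring
      _ ≤ _ := mul_le_mul_of_nonneg_left h1 (Real.exp_pos 1).le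

open Function in
/-- The discrete Gagliardo–Nirenberg–Sobolev inequality in `ℓ¹`. -/
lemma sobolev_lattice (hd : 2 ≤ d) (A : Finset (Vert d)) (w : Vert d → ℝ) (hw : ∀ x, 0 ≤ w x)
    (hA : ∀ x ∉ A, w x = 0) :
    ∑ x ∈ A, w x ^ ((d : ℝ) / (d - 1)) ≤
      (∑ e ∈ edgesIn d A, |dgradE d w e.1 e.2|) ^ ((d : ℝ) / (d - 1)) := by
  have hd1 : (1 : ℝ) < d := by exact_mod_cast hd
  set G : Vert d → ℝ≥0∞ := fun x => ∑ i, ENNReal.ofReal |dgradE d w x i| with hG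
  have hline : ∀ (x : Vert d) (i : Fin d),
      ENNReal.ofReal (w x) ≤ ∑' k : ℤ, G (update x i k) := by
    intro x i
    have hcoord : ∀ k : ℤ, update x i k + unitv d i = update x i (k + 1) := by
      intro k; ext j
      by_cases h : j = i
      · subst h; simp [unitv]
      · simp [unitv, h]
    have hstep : ∀ n : ℕ, ENNReal.ofReal (w x) ≤
        ∑ k ∈ Finset.range n, G (update x i (x i + (k : ℤ))) +
          ENNReal.ofReal (w (update x i (x i + (n : ℤ)))) := by
      intro n
      induction n with
      | zero => simp
      | succ n ih =>
        refine ih.trans ?_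
        rw [Finset.sum_range_succ, add_assoc]
        refine add_le_add le_rfl ?_
        have h1 : ENNReal.ofReal |dgradE d w (update x i (x i + (n : ℤ))) i| ≤
            G (update x i (x i + (n : ℤ))) :=
          Finset.single_le_sum (f := fun j => ENNReal.ofReal
            |dgradE d w (update x i (x i + (n : ℤ))) j|) (fun _ _ => zero_le) (Finset.mem_univ i)
        refine le_trans ?_ (add_le_add_left h1 _)
        rw [← ENNReal.ofReal_add (abs_nonneg _) (hw _)]
        refine ENNReal.ofReal_le_ofReal ?_
        rw [dgradE, hcoord]
        push_cast
        rw [add_assoc]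
        linarith [neg_abs_le (w (update x i (x i + ((n : ℤ) + 1))) - w (update x i (x i + (n : ℤ))))]
    have hfin : ∃ n : ℕ, update x i (x i + (n : ℤ)) ∉ A := by
      have hinj : Function.Injective fun n : ℕ => update x i (x i + (n : ℤ)) := by
        intro a b h
        simpa using congrFun h i
      obtain ⟨n, hn⟩ := Set.Infinite.exists_notMem_finset (Set.infinite_range_of_injective hinj) A
      obtain ⟨⟨m, rfl⟩, hm⟩ := hn
      exact ⟨m, hm⟩
    obtain ⟨n, hn⟩ := hfin
    have h1 := hstep n
    rw [hA _ hn, ENNReal.ofReal_zero, add_zero] at h1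
    refine h1.trans ?_
    have hinj : Function.Injective fun k : ℕ => x i + (k : ℤ) := fun a b h => by simpa using h
    refine (ENNReal.sum_le_tsum _).trans ?_
    exact ENNReal.tsum_comp_le_tsum_of_injective hinj (fun k : ℤ => G (update x i k))
  have hconj : Real.HolderConjugate (Fintype.card (Fin d)) ((d : ℝ) / (d - 1)) := by
    rw [Fintype.card_fin]; exact Real.HolderConjugate.conjExponent hd1
  have hgrid := lintegral_prod_lintegral_pow_le (A := fun _ : Fin d => ℤ)
    (fun _ => Measure.count) hconj (f := G) (by fun_prop)
  have hpi : Measure.pi (fun _ : Fin d => (Measure.count : Measure ℤ)) = Measure.count := by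
    refine Measure.ext_of_singleton fun x => ?_
    rw [Measure.pi_singleton, Measure.count_singleton]
    simp
  rw [hpi] at hgrid
  simp only [lintegral_count, Fintype.card_fin] at hgrid
  have hR : ∑' x, G x = ENNReal.ofReal (∑ e ∈ edgesIn d A, |dgradE d w e.1 e.2|) := by
    rw [hG, ENNReal.ofReal_sum_of_nonneg fun _ _ => abs_nonneg _]
    simp only [← tsum_fintype (L := .unconditional _)]
    rw [← ENNReal.tsum_prod (f := fun x i => ENNReal.ofReal |dgradE d w x i|)]
    refine tsum_eq_sum fun e he => ?_
    rw [mem_edgesIn, not_or] at he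
    simp [dgradE, hA _ he.1, hA _ he.2]
  have hL : ENNReal.ofReal (∑ x ∈ A, w x ^ ((d : ℝ) / (d - 1))) ≤
      ∑' x, ∏ i, (∑' k, G (update x i k)) ^ ((1 : ℝ) / (d - 1)) := by
    rw [ENNReal.ofReal_sum_of_nonneg fun x _ => Real.rpow_nonneg (hw x) _]
    refine le_trans (Finset.sum_le_sum fun x _ => ?_) (ENNReal.sum_le_tsum A)
    calc ENNReal.ofReal (w x ^ ((d : ℝ) / (d - 1)))
        = ∏ _i : Fin d, ENNReal.ofReal (w x) ^ ((1 : ℝ) / (d - 1)) := by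
          rw [Finset.prod_const, Finset.card_univ, Fintype.card_fin, ← ENNReal.rpow_natCast,
            ← ENNReal.rpow_mul, ENNReal.ofReal_rpow_of_nonneg (hw x)
            (mul_nonneg (div_nonneg zero_le_one (by linarith)) (by linarith))]
          congr 2; ring
      _ ≤ _ := Finset.prod_le_prod' fun i _ =>
          ENNReal.rpow_le_rpow (hline x i) (div_nonneg zero_le_one (by linarith))
  have hexp : (0 : ℝ) ≤ d / (d - 1) := div_nonneg (by linarith) (by linarith)
  have := hL.trans hgrid
  rw [hR, ENNReal.ofReal_rpow_of_nonneg (Finset.sum_nonneg fun _ _ => abs_nonneg _) hexp] at this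
  exact (ENNReal.ofReal_le_ofReal_iff
    (Real.rpow_nonneg (Finset.sum_nonneg fun _ _ => abs_nonneg _) _)).1 this

/-- Stampacchia's iteration lemma. -/
lemma stampacchia_decay {g : ℝ → ℝ} (hg0 : ∀ k, 0 ≤ g k) {s t C m k₀ : ℝ} (hs : 0 < s)
    (hst : s < t) (hC : 0 < C) (hm : 0 < m) (hgm : g k₀ ≤ m)
    (hg : ∀ k h, k₀ ≤ k → k < h → (h - k) * g h ^ s ≤ C * g k ^ t) (j : ℕ) :
    g (k₀ + C * m ^ (t - s) * 2 ^ (1 + s / (t - s)) * (1 - 2 ^ (-(j : ℝ)))) ≤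
      m * 2 ^ (-(j / (t - s))) := by
  have hts : 0 < t - s := sub_pos.2 hst
  obtain ⟨K, hK⟩ : ∃ K, K = C * m ^ (t - s) * (2 : ℝ) ^ (1 + s / (t - s)) := ⟨_, rfl⟩
  have hKpos : 0 < K := by rw [hK]; positivity
  rw [← hK]
  induction j with
  | zero => simpa using hgm
  | succ j ih =>
    have hle1 : (2 : ℝ) ^ (-(j : ℝ)) ≤ 1 := by
      rw [Real.rpow_neg zero_le_two]
      exact inv_le_one_of_one_le₀ (Real.one_le_rpow one_le_two (by positivity))
    have hhalf : (2 : ℝ) ^ (-((j + 1 : ℕ) : ℝ)) = 2 ^ (-(j : ℝ)) / 2 := by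
      push_cast
      rw [neg_add, Real.rpow_add zero_lt_two, Real.rpow_neg_one]; rfl
    have hpos : (0 : ℝ) < 2 ^ (-(j : ℝ)) := by positivity
    have h1 := hg (k₀ + K * (1 - 2 ^ (-(j : ℝ)))) (k₀ + K * (1 - 2 ^ (-((j + 1 : ℕ) : ℝ))))
      (by nlinarith) (by rw [hhalf]; nlinarith)
    have hdiff : k₀ + K * (1 - 2 ^ (-((j + 1 : ℕ) : ℝ))) - (k₀ + K * (1 - 2 ^ (-(j : ℝ)))) =
        K * 2 ^ (-((j + 1 : ℕ) : ℝ)) := by rw [hhalf]; ring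
    rw [hdiff] at h1
    have h2 := h1.trans (mul_le_mul_of_nonneg_left
      (Real.rpow_le_rpow (hg0 _) ih (hs.trans hst).le) hC.le)
    refine (Real.rpow_le_rpow_iff (hg0 _) (by positivity) hs).1 ?_
    refine le_of_mul_le_mul_left (h2.trans (le_of_eq ?_))
      (by positivity : (0 : ℝ) < K * 2 ^ (-((j + 1 : ℕ) : ℝ)))
    rw [hK, Real.mul_rpow hm.le (by positivity), Real.mul_rpow hm.le (by positivity),
      ← Real.rpow_mul zero_le_two, ← Real.rpow_mul zero_le_two]
    have hmt : m ^ t = m ^ (t - s) * m ^ s := by rw [← Real.rpow_add hm]; ring_nf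
    have h2t : (2 : ℝ) ^ (-((j : ℝ) / (t - s)) * t) = 2 ^ (1 + s / (t - s)) *
        2 ^ (-((j + 1 : ℕ) : ℝ)) * 2 ^ (-(((j + 1 : ℕ) : ℝ) / (t - s)) * s) := by
      rw [← Real.rpow_add zero_lt_two, ← Real.rpow_add zero_lt_two]
      congr 1
      push_cast
      field_simp
      ring
    rw [hmt, h2t]; ring

lemma sum_le_of_rpow_sum_le {ι : Type*} (T : Finset ι) (a : ι → ℝ) (ha : ∀ e, 0 < a e) {p M : ℝ}
    (hp : 1 < p) (hM : ∑ e ∈ T, a e ^ p ≤ M) :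
    ∑ e ∈ T, a e ≤ M ^ (1 / p) * (T.card : ℝ) ^ (1 - 1 / p) := by
  have hpq := Real.HolderConjugate.conjExponent hp
  have h := Real.inner_le_Lp_mul_Lq_of_nonneg T (f := a) (g := fun _ => 1) hpq
    (fun e _ => (ha e).le) (fun _ _ => zero_le_one)
  simp only [mul_one, Real.one_rpow, Finset.sum_const, nsmul_eq_mul] at h
  have h1 : 1 / Real.conjExponent p = 1 - 1 / p := by
    have := hpq.inv_add_inv_eq_one
    rw [one_div, one_div]; linarith
  rw [h1] at h
  refine h.trans (mul_le_mul_of_nonneg_right ?_ (by positivity))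
  exact Real.rpow_le_rpow (Finset.sum_nonneg fun e _ => Real.rpow_nonneg (ha e).le _) hM
    (by positivity)

lemma card_edgesIn_le (A : Finset (Vert d)) : (edgesIn d A).card ≤ 2 * d * A.card := by
  rw [mul_comm]
  refine Finset.card_biUnion_le_card_mul _ _ _ fun x _ => ?_
  refine (Finset.card_union_le _ _).trans ?_
  have h1 := Finset.card_image_le (s := (Finset.univ : Finset (Fin d))) (f := fun i => (x, i))
  have h2 := Finset.card_image_le (s := (Finset.univ : Finset (Fin d)))
    (f := fun i => (x - unitv d i, i))
  rw [Finset.card_univ, Fintype.card_fin] at h1 h2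
  omega

/-- Measure of superlevel sets in terms of the gradient of a truncation. -/
lemma level_card_le (hd : 2 ≤ d) (A A' : Finset (Vert d)) (hA' : A' ⊆ A) (w : Vert d → ℝ)
    (hw : ∀ x, 0 ≤ w x) (hA : ∀ x ∉ A, w x = 0) {δ : ℝ} (hδ : 0 ≤ δ) (h : ∀ x ∈ A', δ ≤ w x) :
    δ * (A'.card : ℝ) ^ (1 - 1 / (d : ℝ)) ≤ ∑ e ∈ edgesIn d A, |dgradE d w e.1 e.2| := by
  have hd1 : (1 : ℝ) < d := by exact_mod_cast hd
  have hs : 0 < 1 - 1 / (d : ℝ) := by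
    rw [sub_pos, div_lt_one (by linarith)]; exact hd1
  have hD : (d : ℝ) / (d - 1) = (1 - 1 / (d : ℝ))⁻¹ := by
    have : (d : ℝ) - 1 ≠ 0 := by linarith
    field_simp
  have h1 := sobolev_lattice hd A w hw hA
  rw [hD] at h1
  have h2 : (A'.card : ℝ) * δ ^ (1 - 1 / (d : ℝ))⁻¹ ≤ ∑ x ∈ A, w x ^ (1 - 1 / (d : ℝ))⁻¹ := by
    rw [← nsmul_eq_mul]
    refine (Finset.card_nsmul_le_sum A' _ _ fun x hx =>
      Real.rpow_le_rpow hδ (h x hx) (by positivity)).trans ?_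
    exact Finset.sum_le_sum_of_subset_of_nonneg hA' fun x _ _ => Real.rpow_nonneg (hw x) _
  have hnn : 0 ≤ ∑ e ∈ edgesIn d A, |dgradE d w e.1 e.2| :=
    Finset.sum_nonneg fun _ _ => abs_nonneg _
  have h3 := Real.rpow_le_rpow (by positivity) (h2.trans h1) hs.le
  rwa [Real.rpow_inv_rpow hnn hs.ne', Real.mul_rpow (by positivity) (by positivity),
    Real.rpow_inv_rpow hδ hs.ne', mul_comm] at h3

lemma sum_fst_le_edgesIn (A : Finset (Vert d)) (F : EdgeIx d → ℝ) (hF : ∀ e, 0 ≤ F e) (i : Fin d) :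
    ∑ x ∈ A, F (x, i) ≤ ∑ e ∈ edgesIn d A, F e := by
  rw [← Finset.sum_image (s := A) (g := fun x => ((x, i) : EdgeIx d)) (f := F)
    (fun a _ b _ h => by simpa using h)]
  refine Finset.sum_le_sum_of_subset_of_nonneg (fun e he => ?_) (fun e _ _ => hF e)
  obtain ⟨x, hx, rfl⟩ := Finset.mem_image.1 he
  exact mem_edgesIn.2 (Or.inl hx)

/-- Two-level estimate for the superlevel sets of `u - ψ`. -/
lemma level_step (hd : 2 ≤ d) {p q : ℝ} (hp : 1 < p) (hq : 1 < q) {M r V κ : ℝ} (hM : 0 < M)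
    (hr : 0 < r) (hV : 0 < V) (hκ : 0 ≤ κ) (ω : EnvSp d) (B : Finset (Vert d))
    (hωp : ∑ e ∈ edgesIn d B, ω.1 e ^ p ≤ M * V)
    (hωq : ∑ e ∈ edgesIn d B, ω.1 e ^ (-q) ≤ M * V) (u ψ : Vert d → ℝ) (hu0 : ∀ x, 0 ≤ u x)
    (hub : ∀ x ∉ B, u x - ψ x ≤ 0)
    (hu : ∀ x ∈ B, lapl d ω u x = κ * piOf d ω x * u x)
    (hψ : ∀ x i, |ψ (x + unitv d i) - ψ x| ≤ r⁻¹) {k h : ℝ} (hk : 0 ≤ k) (hkh : k < h) :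
    (h - k) * ((B.filter fun x => h < u x - ψ x).card : ℝ) ^ (1 - 1 / (d : ℝ)) ≤
      r⁻¹ * (M * V) ^ ((1 / p + 1 / q) / 2) *
        (2 * d * ((B.filter fun x => k < u x - ψ x).card : ℝ)) ^ (1 - (1 / p + 1 / q) / 2) := by
  set A := B.filter fun x => k < u x - ψ x with hAdef
  set A' := B.filter fun x => h < u x - ψ x with hA'def
  have hAB : A ⊆ B := Finset.filter_subset _ _
  have hA : ∀ x, x ∈ A ↔ k < u x - ψ x := fun x => by
    rw [hAdef, Finset.mem_filter, and_iff_right_iff_imp]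
    intro hx
    by_contra hxB
    linarith [hub x hxB]
  obtain ⟨w, hw⟩ : ∃ w : Vert d → ℝ, ∀ x, w x = max (u x - ψ x - k) 0 := ⟨_, fun _ => rfl⟩
  have hw0 : ∀ x, 0 ≤ w x := fun x => by rw [hw]; exact le_max_right _ _
  have hwA : ∀ x ∉ A, w x = 0 := fun x hx => by
    rw [hA, not_lt] at hx
    rw [hw]; exact max_eq_right (by linarith)
  have hen := energy_le ω B κ r u ψ hu hψ k A hAB hA w hw
  have hd0 : 0 < d := by omega
  have hen1 : ∑ e ∈ edgesIn d A, ω.1 e * dgradE d w e.1 e.2 ^ 2 ≤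
      r⁻¹ ^ 2 * ∑ e ∈ edgesIn d A, ω.1 e := by
    have : 0 ≤ 2 * κ * ∑ x ∈ A, piOf d ω x * u x * w x :=
      mul_nonneg (by linarith) (Finset.sum_nonneg fun x _ =>
        mul_nonneg (mul_nonneg (piOf_pos hd0 ω x).le (hu0 x)) (hw0 x))
    linarith
  have hlev := level_card_le hd A A' (fun x hx => by
      rw [hA'def, Finset.mem_filter] at hx
      rw [hA]; linarith [hx.2]) w hw0 hwA (sub_nonneg.2 hkh.le) (fun x hx => by
      rw [hA'def, Finset.mem_filter] at hx
      rw [hw]; exact le_max_of_le_left (by linarith [hx.2]))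
  refine hlev.trans ?_
  have hcs : (∑ e ∈ edgesIn d A, |dgradE d w e.1 e.2|) ^ 2 ≤
      (∑ e ∈ edgesIn d A, ω.1 e * dgradE d w e.1 e.2 ^ 2) * ∑ e ∈ edgesIn d A, (ω.1 e)⁻¹ := by
    refine Finset.sum_sq_le_sum_mul_sum_of_sq_le_mul _
      (fun e _ => mul_nonneg (ω.2 e).le (sq_nonneg _)) (fun e _ => inv_nonneg.2 (ω.2 e).le)
      (fun e _ => ?_)
    have := (ω.2 e).ne'
    rw [sq_abs]; exact le_of_eq (by field_simp)
  have hsub := edgesIn_mono hAB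
  obtain ⟨N, hN⟩ : ∃ N : ℝ, N = 2 * d * (A.card : ℝ) := ⟨_, rfl⟩
  have hN0 : 0 ≤ N := by rw [hN]; positivity
  have hcard : ((edgesIn d A).card : ℝ) ≤ N := by
    rw [hN]; exact_mod_cast card_edgesIn_le A
  have hp1 : 1 / p < 1 := by rw [div_lt_one (by linarith)]; exact hp
  have hq1 : 1 / q < 1 := by rw [div_lt_one (by linarith)]; exact hq
  have hs1 : ∑ e ∈ edgesIn d A, ω.1 e ≤ (M * V) ^ (1 / p) * N ^ (1 - 1 / p) := by
    refine (sum_le_of_rpow_sum_le _ ω.1 ω.2 hp ((Finset.sum_le_sum_of_subset_of_nonneg hsub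
      fun e _ _ => Real.rpow_nonneg (ω.2 e).le _).trans hωp)).trans ?_
    exact mul_le_mul_of_nonneg_left (Real.rpow_le_rpow (by positivity) hcard (by linarith))
      (by positivity)
  have hs2 : ∑ e ∈ edgesIn d A, (ω.1 e)⁻¹ ≤ (M * V) ^ (1 / q) * N ^ (1 - 1 / q) := by
    refine (sum_le_of_rpow_sum_le _ (fun e => (ω.1 e)⁻¹) (fun e => inv_pos.2 (ω.2 e)) hq
      (le_trans (le_of_eq ?_) ((Finset.sum_le_sum_of_subset_of_nonneg hsub
      fun e _ _ => Real.rpow_nonneg (ω.2 e).le _).trans hωq))).trans ?_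
    · refine Finset.sum_congr rfl fun e _ => ?_
      rw [Real.inv_rpow (ω.2 e).le, Real.rpow_neg (ω.2 e).le]
    · exact mul_le_mul_of_nonneg_left (Real.rpow_le_rpow (by positivity) hcard (by linarith))
        (by positivity)
  refine abs_le_of_sq_le_sq' ?_ (by positivity) |>.2
  rw [← hN]
  have hs1' : 0 ≤ ∑ e ∈ edgesIn d A, ω.1 e := Finset.sum_nonneg fun e _ => (ω.2 e).le
  have hs2' : 0 ≤ ∑ e ∈ edgesIn d A, (ω.1 e)⁻¹ := Finset.sum_nonneg fun e _ =>
    inv_nonneg.2 (ω.2 e).le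
  calc _ ≤ _ := hcs
    _ ≤ (r⁻¹ ^ 2 * ((M * V) ^ (1 / p) * N ^ (1 - 1 / p))) *
        ((M * V) ^ (1 / q) * N ^ (1 - 1 / q)) := by
      refine mul_le_mul (hen1.trans ?_) hs2 hs2' (by positivity)
      exact mul_le_mul_of_nonneg_left hs1 (by positivity)
    _ = r⁻¹ ^ 2 * ((M * V) ^ (1 / p) * (M * V) ^ (1 / q)) *
        (N ^ (1 - 1 / p) * N ^ (1 - 1 / q)) := by ring
    _ = _ := by
      rw [mul_pow, mul_pow, ← Real.rpow_add (by positivity),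
        ← Real.rpow_add_of_nonneg hN0 (by linarith) (by linarith),
        ← Real.rpow_mul_natCast (by positivity), ← Real.rpow_mul_natCast hN0]
      congr 2
      · congr 1; push_cast; ring
      · push_cast; ring

/-- Smallness of the superlevel set at height `k`, coming from the killing term. -/
lemma level_init (hd : 2 ≤ d) {p q : ℝ} (hp : 1 < p) (hq : 1 < q) {M r V κ : ℝ} (hM : 0 < M)
    (hV : 0 < V) (hκ : 0 < κ) (ω : EnvSp d) (B : Finset (Vert d))
    (hB : (B.card : ℝ) ≤ M * V)
    (hωp : ∑ e ∈ edgesIn d B, ω.1 e ^ p ≤ M * V)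
    (hωq : ∑ e ∈ edgesIn d B, ω.1 e ^ (-q) ≤ M * V) (u ψ : Vert d → ℝ) (hu0 : ∀ x, 0 ≤ u x)
    (hψ0 : ∀ x, 0 ≤ ψ x) (hub : ∀ x ∉ B, u x - ψ x ≤ 0)
    (hu : ∀ x ∈ B, lapl d ω u x = κ * piOf d ω x * u x)
    (hψ : ∀ x i, |ψ (x + unitv d i) - ψ x| ≤ r⁻¹) {k : ℝ} (hk : 0 < k) :
    ((B.filter fun x => k < u x - ψ x).card : ℝ) ^ 2 * (κ * k ^ 2) ≤
      r⁻¹ ^ 2 * (2 * d * (M * V)) ^ 2 := by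
  have hd0 : 0 < d := by omega
  set A := B.filter fun x => (0 : ℝ) < u x - ψ x with hAdef
  set A' := B.filter fun x => k < u x - ψ x with hA'def
  have hAB : A ⊆ B := Finset.filter_subset _ _
  have hA'B : A' ⊆ B := Finset.filter_subset _ _
  have hA : ∀ x, x ∈ A ↔ 0 < u x - ψ x := fun x => by
    rw [hAdef, Finset.mem_filter, and_iff_right_iff_imp]
    intro hx
    by_contra hxB
    linarith [hub x hxB]
  have hA'A : A' ⊆ A := fun x hx => by
    rw [hA'def, Finset.mem_filter] at hx
    rw [hA]; linarith [hx.2]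
  obtain ⟨w, hw⟩ : ∃ w : Vert d → ℝ, ∀ x, w x = max (u x - ψ x - 0) 0 := ⟨_, fun _ => rfl⟩
  have hw0 : ∀ x, 0 ≤ w x := fun x => by rw [hw]; exact le_max_right _ _
  have hen := energy_le ω B κ r u ψ hu hψ 0 A hAB hA w hw
  have hdV : M * V ≤ 2 * d * (M * V) := by
    have : (1 : ℝ) ≤ 2 * d := by
      have : (2 : ℝ) ≤ d := by exact_mod_cast hd
      linarith
    nlinarith [mul_pos hM hV]
  have hall : ∀ (a : EdgeIx d → ℝ), (∀ e, 0 < a e) → ∀ {s : ℝ}, 1 < s →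
      ∑ e ∈ edgesIn d B, a e ^ s ≤ M * V → ∑ e ∈ edgesIn d B, a e ≤ 2 * d * (M * V) := by
    intro a ha s hs hsum
    have hs1 : 1 / s < 1 := by rw [div_lt_one (by linarith)]; exact hs
    have hc : ((edgesIn d B).card : ℝ) ≤ 2 * d * (M * V) := by
      have h1 : ((edgesIn d B).card : ℝ) ≤ 2 * d * (B.card : ℝ) := by
        exact_mod_cast card_edgesIn_le B
      exact h1.trans (mul_le_mul_of_nonneg_left hB (by positivity))
    have h := sum_le_of_rpow_sum_le _ a ha hs (hsum.trans hdV)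
    refine h.trans ((mul_le_mul_of_nonneg_left (Real.rpow_le_rpow (by positivity) hc
      (by linarith)) (by positivity)).trans (le_of_eq ?_))
    have hpos : 0 < 2 * (d : ℝ) * (M * V) := lt_of_lt_of_le (by positivity) hdV
    rw [← Real.rpow_add hpos, add_sub_cancel, Real.rpow_one]
  have hω := hall ω.1 ω.2 hp hωp
  have hωi := hall (fun e => (ω.1 e)⁻¹) (fun e => inv_pos.2 (ω.2 e)) hq (le_trans (le_of_eq
    (Finset.sum_congr rfl fun e _ => by
      rw [Real.inv_rpow (ω.2 e).le, Real.rpow_neg (ω.2 e).le])) hωq)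
  obtain ⟨W, hW⟩ : ∃ W : ℝ, W = 2 * d * (M * V) := ⟨_, rfl⟩
  rw [← hW] at hω hωi ⊢
  have hkill : κ * k ^ 2 * ∑ x ∈ A', piOf d ω x ≤ r⁻¹ ^ 2 * W := by
    have h1 : ∑ x ∈ A', k ^ 2 * piOf d ω x ≤ ∑ x ∈ A, piOf d ω x * u x * w x := by
      refine le_trans (Finset.sum_le_sum fun x hx => ?_) (Finset.sum_le_sum_of_subset_of_nonneg hA'A
        fun x _ _ => mul_nonneg (mul_nonneg (piOf_pos hd0 ω x).le (hu0 x)) (hw0 x))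
      rw [hA'def, Finset.mem_filter] at hx
      have h2 : k ≤ u x := by linarith [hx.2, hψ0 x]
      have h3 : k ≤ w x := by rw [hw]; exact le_max_of_le_left (by linarith [hx.2])
      have h4 : k ^ 2 ≤ u x * w x := by rw [sq]; exact mul_le_mul h2 h3 hk.le (hu0 x)
      have := mul_le_mul_of_nonneg_left h4 (piOf_pos hd0 ω x).le
      linarith
    rw [← Finset.mul_sum] at h1
    have h2 : 0 ≤ ∑ e ∈ edgesIn d A, ω.1 e * dgradE d w e.1 e.2 ^ 2 :=
      Finset.sum_nonneg fun e _ => mul_nonneg (ω.2 e).le (sq_nonneg _)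
    have h3 : ∑ e ∈ edgesIn d A, ω.1 e ≤ W :=
      (Finset.sum_le_sum_of_subset_of_nonneg (edgesIn_mono hAB) fun e _ _ => (ω.2 e).le).trans hω
    have h4 := mul_le_mul_of_nonneg_left h3 (sq_nonneg r⁻¹)
    have h5 : 0 ≤ k ^ 2 * ∑ x ∈ A', piOf d ω x :=
      mul_nonneg (sq_nonneg _) (Finset.sum_nonneg fun x _ => (piOf_pos hd0 ω x).le)
    have h6 := mul_le_mul_of_nonneg_left h1 hκ.le
    have h7 := mul_nonneg hκ.le h5
    linarith
  have hinv : ∑ x ∈ A', (piOf d ω x)⁻¹ ≤ W := by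
    refine le_trans (Finset.sum_le_sum (g := fun x => (ω.1 (x, (⟨0, hd0⟩ : Fin d)))⁻¹)
      fun x _ => ?_) ((Finset.sum_le_sum_of_subset_of_nonneg hA'B fun x _ _ =>
        inv_nonneg.2 (ω.2 _).le).trans ((sum_fst_le_edgesIn B (fun e => (ω.1 e)⁻¹)
          (fun e => inv_nonneg.2 (ω.2 e).le) _).trans hωi))
    refine inv_anti₀ (ω.2 _) (le_trans ?_ (Finset.single_le_sum
      (f := fun i => ω.1 (x, i) + ω.1 (x - unitv d i, i))
      (fun i _ => (add_pos (ω.2 _) (ω.2 _)).le) (Finset.mem_univ ⟨0, hd0⟩)))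
    exact le_add_of_nonneg_right (ω.2 _).le
  have hcs : (A'.card : ℝ) ^ 2 ≤ (∑ x ∈ A', piOf d ω x) * ∑ x ∈ A', (piOf d ω x)⁻¹ := by
    have := Finset.sum_sq_le_sum_mul_sum_of_sq_le_mul A' (r := fun _ => (1 : ℝ))
      (f := fun x => piOf d ω x) (g := fun x => (piOf d ω x)⁻¹)
      (fun x _ => (piOf_pos hd0 ω x).le) (fun x _ => inv_nonneg.2 (piOf_pos hd0 ω x).le)
      (fun x _ => by rw [mul_inv_cancel₀ (piOf_pos hd0 ω x).ne', one_pow])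
    simpa using this
  have hπ0 : 0 ≤ ∑ x ∈ A', piOf d ω x := Finset.sum_nonneg fun x _ => (piOf_pos hd0 ω x).le
  have hi0 : 0 ≤ ∑ x ∈ A', (piOf d ω x)⁻¹ :=
    Finset.sum_nonneg fun x _ => inv_nonneg.2 (piOf_pos hd0 ω x).le
  calc (A'.card : ℝ) ^ 2 * (κ * k ^ 2)
      ≤ ((∑ x ∈ A', piOf d ω x) * ∑ x ∈ A', (piOf d ω x)⁻¹) * (κ * k ^ 2) :=
        mul_le_mul_of_nonneg_right hcs (by positivity)
    _ = (κ * k ^ 2 * ∑ x ∈ A', piOf d ω x) * ∑ x ∈ A', (piOf d ω x)⁻¹ := by ring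
    _ ≤ (r⁻¹ ^ 2 * W) * W := mul_le_mul hkill hinv hi0 (mul_nonneg (sq_nonneg _) (hi0.trans hinv))
    _ = _ := by ring

/-- A solution of the killed equation is at most its barrier plus a power of the killing rate. -/
lemma exists_sub_barrier_le (hd : 2 ≤ d) {p q : ℝ} (hp : 1 < p) (hq : 1 < q)
    (hpq : (1 / p + 1 / q) / 2 < 1 / (d : ℝ)) {M ρ : ℝ} (hM : 0 < M) (hρ : 0 < ρ) :
    ∃ C : ℝ, 0 < C ∧ ∀ R κ : ℝ, 0 < R → 1 ≤ κ * R ^ 2 → ∀ (ω : EnvSp d) (B : Finset (Vert d)),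
      (B.card : ℝ) ≤ M * R ^ d → ∑ e ∈ edgesIn d B, ω.1 e ^ p ≤ M * R ^ d →
      ∑ e ∈ edgesIn d B, ω.1 e ^ (-q) ≤ M * R ^ d → ∀ u ψ : Vert d → ℝ,
      (∀ x, 0 ≤ u x) → (∀ x, 0 ≤ ψ x) → (∀ x ∉ B, u x - ψ x ≤ 0) →
      (∀ x ∈ B, lapl d ω u x = κ * piOf d ω x * u x) →
      (∀ x i, |ψ (x + unitv d i) - ψ x| ≤ (ρ * R)⁻¹) → ∀ x,
      u x - ψ x ≤ C * (κ * R ^ 2) ^ (-((1 / (d : ℝ) - (1 / p + 1 / q) / 2) / 4)) := by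
  obtain ⟨θ, hθ⟩ : ∃ θ : ℝ, θ = (1 / p + 1 / q) / 2 := ⟨_, rfl⟩
  have hθ0 : 0 < θ := by rw [hθ]; positivity
  have hd2 : (2 : ℝ) ≤ d := by exact_mod_cast hd
  have hd1 : 1 / (d : ℝ) ≤ 1 / 2 := one_div_le_one_div_of_le (by norm_num) hd2
  rw [← hθ] at hpq ⊢
  obtain ⟨δ, hδ⟩ : ∃ δ : ℝ, δ = 1 / (d : ℝ) - θ := ⟨_, rfl⟩
  have hδ0 : 0 < δ := by rw [hδ]; linarith
  obtain ⟨C₁, hC₁⟩ : ∃ C₁ : ℝ, C₁ = ρ⁻¹ * M ^ θ * (2 * d) ^ (1 - θ) := ⟨_, rfl⟩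
  have hC₁0 : 0 < C₁ := by rw [hC₁]; positivity
  obtain ⟨c₀, hc₀⟩ : ∃ c₀ : ℝ, c₀ = 2 * d * M * ρ⁻¹ := ⟨_, rfl⟩
  have hc₀0 : 0 < c₀ := by rw [hc₀]; positivity
  have hst : 1 - θ - (1 - 1 / (d : ℝ)) = δ := by rw [hδ]; ring
  refine ⟨1 + C₁ * c₀ ^ δ * 2 ^ (1 + (1 - 1 / (d : ℝ)) / δ), by positivity, ?_⟩
  intro R κ hR hL ω B hB hωp hωq u ψ hu0 hψ0 hub hu hψ x
  have hκ : 0 < κ := pos_of_mul_pos_left (by linarith) (sq_nonneg R)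
  rw [← hδ]
  obtain ⟨L, hLdef⟩ : ∃ L : ℝ, L = κ * R ^ 2 := ⟨_, rfl⟩
  rw [← hLdef] at hL ⊢
  have hL0 : 0 < L := by linarith
  obtain ⟨y, hy⟩ : ∃ y : ℝ, y = L ^ (-(1 / 4) : ℝ) := ⟨_, rfl⟩
  have hy0 : 0 < y := by rw [hy]; positivity
  have hy1 : y ≤ 1 := by rw [hy]; exact Real.rpow_le_one_of_one_le_of_nonpos hL (by norm_num)
  have hy4 : L * y ^ 4 = 1 := by
    rw [hy, ← Real.rpow_mul_natCast hL0.le]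
    norm_num
    rw [Real.rpow_neg_one, mul_inv_cancel₀ hL0.ne']
  have hyδ : L ^ (-(δ / 4)) = y ^ δ := by
    rw [hy, ← Real.rpow_mul hL0.le]; congr 1; ring
  have hV : 0 < R ^ d := pow_pos hR d
  have hVs : (R ^ d) ^ (1 - 1 / (d : ℝ)) = R ^ d / R := by
    rw [Real.rpow_sub hV, Real.rpow_one, one_div, Real.pow_rpow_inv_natCast hR.le (by omega)]
  obtain ⟨g, hg⟩ : ∃ g : ℝ → ℝ, ∀ k, g k = ((B.filter fun x => k < u x - ψ x).card : ℝ) / R ^ d :=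
    ⟨_, fun _ => rfl⟩
  have hg0 : ∀ k, 0 ≤ g k := fun k => by rw [hg]; positivity
  have hgm : g y ≤ c₀ * y := by
    have h := level_init hd hp hq hM hV hκ ω B hB hωp hωq u ψ hu0 hψ0 hub hu hψ hy0
    refine abs_le_of_sq_le_sq' ?_ (by positivity) |>.2
    rw [hg, div_pow, div_le_iff₀ (by positivity), hc₀]
    have h2 := mul_le_mul_of_nonneg_left h (show 0 ≤ R ^ 2 * y ^ 2 by positivity)
    calc _ = L * y ^ 4 * ((B.filter fun x => y < u x - ψ x).card : ℝ) ^ 2 := by rw [hy4, one_mul]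
      _ = R ^ 2 * y ^ 2 * (((B.filter fun x => y < u x - ψ x).card : ℝ) ^ 2 * (κ * y ^ 2)) := by
        rw [hLdef]; ring
      _ ≤ _ := h2
      _ = _ := by field_simp
  have hstep : ∀ k h, y ≤ k → k < h →
      (h - k) * g h ^ (1 - 1 / (d : ℝ)) ≤ C₁ * g k ^ (1 - θ) := by
    intro k h hk hkh
    have h1 := level_step hd hp hq hM (mul_pos hρ hR) hV hκ.le ω B hωp hωq u ψ hu0 hub hu hψ
      (hy0.le.trans hk) hkh
    rw [← hθ, Real.mul_rpow hM.le hV.le, Real.mul_rpow (by positivity) (by positivity)] at h1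
    rw [hg, hg, Real.div_rpow (by positivity) hV.le, Real.div_rpow (by positivity) hV.le, hVs, hC₁]
    have hVθ : (R ^ d) ^ θ * (R ^ d) ^ (1 - θ) = R ^ d := by
      rw [← Real.rpow_add hV, add_sub_cancel, Real.rpow_one]
    have hVt : 0 < (R ^ d) ^ (1 - θ) := by positivity
    obtain ⟨a, ha⟩ : ∃ a : ℝ, a = (R ^ d) ^ (1 - θ) := ⟨_, rfl⟩
    obtain ⟨b, hb⟩ : ∃ b : ℝ, b = (R ^ d) ^ θ := ⟨_, rfl⟩
    rw [← ha, ← hb] at hVθ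
    rw [← ha] at hVt ⊢
    rw [← hb] at h1
    have hb0 : 0 < b := by rw [hb]; positivity
    rw [← hVθ]
    have h2 := mul_le_mul_of_nonneg_right h1 (show 0 ≤ R / (b * a) by positivity)
    refine le_trans (le_of_eq ?_) (h2.trans (le_of_eq ?_))
    · field_simp
    · field_simp
  by_contra! hcon
  have hw : y + C₁ * (c₀ * y) ^ δ * 2 ^ (1 + (1 - 1 / (d : ℝ)) / δ) < u x - ψ x := by
    refine lt_of_le_of_lt ?_ hcon
    rw [hyδ, Real.mul_rpow hc₀0.le hy0.le]
    have : y ≤ y ^ δ := by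
      conv_lhs => rw [← Real.rpow_one y]
      exact Real.rpow_le_rpow_of_exponent_ge hy0 hy1 (by linarith)
    nlinarith
  have hxB : x ∈ B := by
    by_contra hx
    have := hub x hx
    have : 0 < y + C₁ * (c₀ * y) ^ δ * 2 ^ (1 + (1 - 1 / (d : ℝ)) / δ) := by positivity
    linarith
  obtain ⟨j, hj⟩ := exists_pow_lt_of_lt_one (show 0 < 1 / (R ^ d * (c₀ * y)) by positivity)
    (show (2 : ℝ) ^ (-(1 / δ)) < 1 from
      Real.rpow_lt_one_of_one_lt_of_neg (by norm_num) (neg_neg_of_pos (by positivity)))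
  have hdec := stampacchia_decay hg0 (show 0 < 1 - 1 / (d : ℝ) by linarith)
    (by linarith) hC₁0 (show 0 < c₀ * y by positivity) hgm hstep j
  rw [hst] at hdec
  have hone : 1 / R ^ d ≤ g (y + C₁ * (c₀ * y) ^ δ * 2 ^ (1 + (1 - 1 / (d : ℝ)) / δ) *
      (1 - 2 ^ (-(j : ℝ)))) := by
    rw [hg]
    refine div_le_div_of_nonneg_right ?_ hV.le
    have : 0 < (B.filter fun z => y + C₁ * (c₀ * y) ^ δ * 2 ^ (1 + (1 - 1 / (d : ℝ)) / δ) *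
      (1 - 2 ^ (-(j : ℝ))) < u z - ψ z).card := by
      refine Finset.card_pos.2 ⟨x, Finset.mem_filter.2 ⟨hxB, lt_of_le_of_lt ?_ hw⟩⟩
      refine add_le_add_right (mul_le_of_le_one_right (by positivity) ?_) _
      have : 0 < (2 : ℝ) ^ (-(j : ℝ)) := by positivity
      linarith
    exact_mod_cast this
  have hpow : (2 : ℝ) ^ (-((j : ℝ) / δ)) = ((2 : ℝ) ^ (-(1 / δ))) ^ j := by
    rw [← Real.rpow_mul_natCast (by norm_num)]; congr 1; ring
  rw [hpow] at hdec
  have h3 := mul_lt_mul_of_pos_left hj (show 0 < c₀ * y by positivity)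
  have h4 : c₀ * y * (1 / (R ^ d * (c₀ * y))) = 1 / R ^ d := by field_simp
  linarith

lemma mem_box_iff (hd : 0 < d) {r : ℝ} {y : Vert d} : y ∈ box d r ↔ ‖y‖ ≤ r := by
  have : Nonempty (Fin d) := ⟨⟨0, hd⟩⟩
  rw [pi_norm_le_iff_of_nonempty]
  simp only [box, Fintype.mem_piFinset, Finset.mem_Icc, Int.ceil_le, Int.le_floor,
    Int.norm_eq_abs, abs_le]

lemma norm_unitv_le (i : Fin d) : ‖unitv d i‖ ≤ 1 := by
  refine (pi_norm_le_iff_of_nonneg zero_le_one).2 fun j => ?_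
  unfold unitv
  split_ifs <;> simp

lemma card_box (n : ℕ) : ((box d (n : ℝ)).card : ℝ) = (2 * n + 1) ^ d := by
  have h : ⌈-(n : ℝ)⌉ = -(n : ℤ) := by exact_mod_cast Int.ceil_intCast (R := ℝ) (-(n : ℤ))
  have h2 : ((n : ℤ) + 1 - -(n : ℤ)).toNat = 2 * n + 1 := by omega
  simp only [box, Fintype.card_piFinset, Int.card_Icc, h, Int.floor_natCast, h2,
    Finset.prod_const, Finset.card_univ, Fintype.card_fin]
  push_cast
  rfl

/-- The translated box `x + Λ_r`. -/
def boxAt (d : ℕ) (r : ℝ) (x : Vert d) : Finset (Vert d) := (box d r).image fun y => y + x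

lemma mem_boxAt {r : ℝ} {x y : Vert d} : y ∈ boxAt d r x ↔ y - x ∈ box d r := by
  simp only [boxAt, Finset.mem_image]
  exact ⟨fun ⟨z, hz, h⟩ => by rwa [← h, add_sub_cancel_right], fun h => ⟨_, h, sub_add_cancel _ _⟩⟩

lemma boxAt_subset_box (hd : 0 < d) {r s T : ℝ} (h : s + r ≤ T) {x : Vert d} (hx : x ∈ box d s) :
    boxAt d r x ⊆ box d T := by
  intro y hy
  rw [mem_boxAt, mem_box_iff hd] at hy
  rw [mem_box_iff hd] at hx ⊢
  linarith [norm_le_norm_add_norm_sub' y x]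

/-- Moments of the conductances and volume of all boxes of a given scale are comparable
with the volume of that scale. -/
lemma exists_moment_le (hd : 0 < d) {p q : ℝ} {ω : EnvSp d} (hmom : InOmegaPQ d p q ω) {T : ℝ}
    (hT : 0 < T) : ∃ M : ℝ, 0 < M ∧ ∀ R : ℝ, 1 ≤ R → ∀ B ⊆ box d (T * R),
      (B.card : ℝ) ≤ M * R ^ d ∧ ∑ e ∈ edgesIn d B, ω.1 e ^ p ≤ M * R ^ d ∧
      ∑ e ∈ edgesIn d B, ω.1 e ^ (-q) ≤ M * R ^ d := by
  obtain ⟨⟨Cp, hCp⟩, Cq, hCq⟩ := hmom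
  refine ⟨(|Cp| + |Cq| + 3 ^ d) * (T + 1) ^ d, by positivity, fun R hR B hB => ?_⟩
  obtain ⟨n, hn⟩ : ∃ n : ℕ, n = ⌈T * R⌉₊ := ⟨_, rfl⟩
  have hTR : 0 < T * R := by positivity
  have hn1 : 1 ≤ n := by rw [hn]; exact Nat.ceil_pos.2 hTR
  have hn1' : (1 : ℝ) ≤ n := by exact_mod_cast hn1
  have hnle : (n : ℝ) ≤ (T + 1) * R := by
    have := Nat.ceil_lt_add_one hTR.le
    rw [← hn] at this
    linarith
  have hBn : B ⊆ box d (n : ℝ) := hB.trans fun y hy => by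
    rw [mem_box_iff hd] at hy ⊢
    exact hy.trans (by rw [hn]; exact Nat.le_ceil _)
  have hpow : (n : ℝ) ^ d ≤ (T + 1) ^ d * R ^ d := by
    rw [← mul_pow]; exact pow_le_pow_left₀ (by positivity) hnle d
  have hn0 : (0 : ℝ) < (n : ℝ) ^ d := by positivity
  have key : ∀ {a c : ℝ}, a ≤ c * (n : ℝ) ^ d → c ≤ |Cp| + |Cq| + 3 ^ d →
      a ≤ (|Cp| + |Cq| + 3 ^ d) * (T + 1) ^ d * R ^ d := by
    intro a c ha hc
    rw [mul_assoc]
    exact ha.trans ((mul_le_mul_of_nonneg_right hc hn0.le).trans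
      (mul_le_mul_of_nonneg_left hpow (by positivity)))
  have hsum : ∀ {s C : ℝ}, (∑ e ∈ edgesIn d (box d (n : ℝ)), ω.1 e ^ s) / (n : ℝ) ^ d ≤ C →
      ∑ e ∈ edgesIn d B, ω.1 e ^ s ≤ C * (n : ℝ) ^ d := fun h =>
    (Finset.sum_le_sum_of_subset_of_nonneg (edgesIn_mono hBn)
      fun e _ _ => Real.rpow_nonneg (ω.2 e).le _).trans ((div_le_iff₀ hn0).1 h)
  have h3 : (0 : ℝ) < 3 ^ d := by positivity
  refine ⟨key (c := 3 ^ d) ?_ (by linarith [abs_nonneg Cp, abs_nonneg Cq]),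
    key (hsum (hCp n hn1)) (by linarith [le_abs_self Cp, abs_nonneg Cq]),
    key (hsum (hCq n hn1)) (by linarith [le_abs_self Cq, abs_nonneg Cp])⟩
  have h1 : (B.card : ℝ) ≤ (box d (n : ℝ)).card := by exact_mod_cast Finset.card_le_card hBn
  refine h1.trans ?_
  rw [card_box, ← mul_pow]
  exact pow_le_pow_left₀ (by positivity) (by linarith) d

/-- Exit-time estimate with a small positive power. -/
lemma exists_exitP_le (hd : 2 ≤ d) {p q : ℝ} (hp : 1 < p) (hq : 1 < q)
    (hpq : (1 / p + 1 / q) / 2 < 1 / (d : ℝ)) {ω : EnvSp d} (hmom : InOmegaPQ d p q ω) {S ρ : ℝ}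
    (hS : 0 < S) (hρ : 0 < ρ) : ∃ C : ℝ, 1 ≤ C ∧ ∀ R : ℝ, 1 ≤ R → ∀ x ∈ box d (S * R),
      ∀ n : ℕ, 0 < n → (n : ℝ) ≤ R ^ 2 → exitP d ω (boxAt d (ρ * R) x) n x ≤
        C * (n / R ^ 2) ^ ((1 / (d : ℝ) - (1 / p + 1 / q) / 2) / 4) := by
  have hd0 : 0 < d := by omega
  obtain ⟨M, hM, hmoment⟩ := exists_moment_le hd0 hmom (add_pos hS hρ)
  obtain ⟨C, hC, hbar⟩ := exists_sub_barrier_le hd hp hq hpq hM hρ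
  refine ⟨max 1 (Real.exp 1 * C), le_max_left _ _, fun R hR x hx n hn hnR => ?_⟩
  have hR0 : 0 < R := by linarith
  have hn0 : (0 : ℝ) < n := by exact_mod_cast hn
  have hr : 0 < ρ * R := by positivity
  obtain ⟨hB, hωp, hωq⟩ := hmoment R hR (boxAt d (ρ * R) x)
    (boxAt_subset_box hd0 (by rw [add_mul]) hx)
  obtain ⟨u, hu0, hu1, hu, hex⟩ := exists_killed_solution hd0 ω (boxAt d (ρ * R) x) n hn
  have hκ : (n : ℝ)⁻¹ * R ^ 2 = (n / R ^ 2)⁻¹ := by field_simp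
  have h := hbar R (n : ℝ)⁻¹ hR0
    (by rw [inv_mul_eq_div, one_le_div hn0]; exact hnR) ω (boxAt d (ρ * R) x) hB hωp hωq u
    (fun y => ‖y - x‖ / (ρ * R)) hu0 (fun y => by positivity)
    (fun y hy => by
      rw [mem_boxAt, mem_box_iff hd0, not_le] at hy
      have := (one_lt_div hr).2 hy
      linarith [hu1 y]) hu
    (fun y i => by
      rw [← sub_div, abs_div, abs_of_pos hr, ← one_div]
      refine div_le_div_of_nonneg_right ((abs_norm_sub_norm_le _ _).trans ?_) hr.le
      rw [sub_sub_sub_cancel_right, add_sub_cancel_left]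
      exact norm_unitv_le i) x
  rw [sub_self, norm_zero, zero_div, sub_zero, hκ, Real.inv_rpow (by positivity),
    Real.rpow_neg (by positivity), inv_inv] at h
  refine (hex x).trans ((mul_le_mul_of_nonneg_left h (Real.exp_pos 1).le).trans ?_)
  rw [← mul_assoc]
  exact mul_le_mul_of_nonneg_right (le_max_right _ _) (by positivity)

/-- Exiting a large box requires exiting many smaller boxes in a row. -/
lemma exitP_boxAt_le_pow (hd : 0 < d) (ω : EnvSp d) {K T b : ℝ} (hK : 0 ≤ K) {n : ℕ}
    (hb : ∀ x ∈ box d T, exitP d ω (boxAt d K x) n x ≤ b) (j : ℕ) :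
    ∀ x ∈ box d (T - j * (K + 1)), exitP d ω (boxAt d (j * (K + 1)) x) n x ≤ b ^ j := by
  induction j with
  | zero => intro x _; rw [pow_zero]; exact exitP_le_one hd ω _ n x
  | succ j ih =>
    intro x hx
    rw [mem_box_iff hd] at hx
    push_cast at hx ⊢
    have hj : 0 ≤ (j : ℝ) * (K + 1) := by positivity
    have hxT : x ∈ box d T := by
      rw [mem_box_iff hd]; linarith
    have hb0 : 0 ≤ b := (exitP_nonneg hd ω _ n x).trans (hb x hxT)
    have hnear : ∀ z : Vert d, ‖z - x‖ ≤ K + 1 →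
        exitP d ω (boxAt d (((j : ℝ) + 1) * (K + 1)) x) n z ≤ b ^ j := by
      intro z hz
      refine (exitP_anti hd ω (fun y hy => ?_) n z).trans (ih z ?_)
      · rw [mem_boxAt, mem_box_iff hd] at hy ⊢
        linarith [norm_sub_le_norm_sub_add_norm_sub y z x]
      · rw [mem_box_iff hd]
        linarith [norm_le_norm_add_norm_sub' z x]
    have hsub : boxAt d K x ⊆ boxAt d (((j : ℝ) + 1) * (K + 1)) x := by
      intro y hy
      rw [mem_boxAt, mem_box_iff hd] at hy ⊢
      linarith
    have hxK : x ∈ boxAt d K x := by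
      rw [mem_boxAt, mem_box_iff hd, sub_self, norm_zero]; exact hK
    have h := exitP_le_mul hd ω hsub n (b ^ j)
      (fun y hy i _ => hnear _ (by
        rw [mem_boxAt, mem_box_iff hd] at hy
        rw [add_sub_right_comm]
        linarith [norm_add_le (y - x) (unitv d i), norm_unitv_le i]))
      (fun y hy i _ => hnear _ (by
        rw [mem_boxAt, mem_box_iff hd] at hy
        rw [sub_right_comm]
        linarith [norm_sub_le (y - x) (unitv d i), norm_unitv_le i])) n le_rfl x hxK
    rw [pow_succ]
    exact h.trans (mul_le_mul_of_nonneg_left (hb x hxT) (pow_nonneg hb0 j))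

end ExitTimes

/-- STATEMENT 6 (Proposition 2.6): exit-time estimate. -/
theorem statement6 (d : ℕ) (hd : 2 ≤ d) (p q : ℝ)
    (hp : (d : ℝ) / 2 < p) (hq : (d : ℝ) / 2 < q) (hpq : 1 / p + 1 / q < 2 / (d : ℝ))
    (α σ : ℝ) (hα : 0 < α) (hσ : 0 < σ)
    (ω : EnvSp d) (hmom : InOmegaPQ d p q ω)
    (μ : Vert d → Measure (Path d)) (hμ : ∀ x, IsWalkLaw d ω x (μ x)) :
    ∃ R₀ c : ℝ, 1 ≤ R₀ ∧ 1 ≤ c ∧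
      ∀ R : ℝ, R₀ ≤ R → ∀ t : ℝ, 0 ≤ t → ∀ x ∈ box d R,
        μ x {w | ∃ k : ℕ, (k : ℝ) ≤ t ∧ w k - x ∉ box d (σ * R)} ≤
          ENNReal.ofReal (c * (t / R ^ 2) ^ α) := by
  have hd0 : 0 < d := by omega
  have hd2 : (2 : ℝ) ≤ d := by exact_mod_cast hd
  have hp1 : 1 < p := by linarith
  have hq1 : 1 < q := by linarith
  have hpq2 : (1 / p + 1 / q) / 2 < 1 / (d : ℝ) := by
    have : 2 / (d : ℝ) = 2 * (1 / (d : ℝ)) := by ring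
    linarith
  obtain ⟨β, hβ⟩ : ∃ β : ℝ, β = (1 / (d : ℝ) - (1 / p + 1 / q) / 2) / 4 := ⟨_, rfl⟩
  have hβ0 : 0 < β := by rw [hβ]; linarith
  obtain ⟨N, hN⟩ : ∃ N : ℕ, N = ⌈α / β⌉₊ := ⟨_, rfl⟩
  have hN1 : 1 ≤ N := by rw [hN]; exact Nat.ceil_pos.2 (div_pos hα hβ0)
  have hN0 : (0 : ℝ) < N := by exact_mod_cast hN1
  have hNα : α ≤ β * N := by
    rw [mul_comm, ← div_le_iff₀ hβ0, hN]; exact Nat.le_ceil _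
  obtain ⟨C, hC1, hC⟩ := exists_exitP_le hd hp1 hq1 hpq2 hmom
    (add_pos one_pos hσ) (show 0 < σ / (2 * N) by positivity)
  rw [← hβ] at hC
  refine ⟨max 1 (2 * N / σ), C ^ N, le_max_left _ _, one_le_pow₀ hC1, ?_⟩
  intro R hR t ht x hx
  have hR1 : 1 ≤ R := (le_max_left _ _).trans hR
  have hR0 : 0 < R := by linarith
  have hRσ : 2 * N ≤ σ * R := by
    have := (le_max_right _ _).trans hR
    rwa [div_le_iff₀' hσ] at this
  have := (hμ x).1
  rcases lt_or_ge (R ^ 2) t with htR | htR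
  · refine prob_le_one.trans (ENNReal.one_le_ofReal.2 ?_)
    refine one_le_mul_of_one_le_of_one_le (one_le_pow₀ hC1) (Real.one_le_rpow ?_ hα.le)
    exact (one_le_div (by positivity)).2 htR.le
  refine le_trans (measure_mono ?_) ((walk_exit_le hd0 ω (hμ x) (boxAt d (σ * R) x) ⌊t⌋₊).trans
    (ENNReal.ofReal_le_ofReal ?_))
  · rintro w ⟨k, hk, hw⟩
    exact ⟨k, Nat.le_floor hk, fun h => hw (mem_boxAt.1 h)⟩
  rcases Nat.eq_zero_or_pos ⌊t⌋₊ with hn | hn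
  · have hxB : x ∈ boxAt d (σ * R) x := by
      rw [mem_boxAt, mem_box_iff hd0, sub_self, norm_zero]; positivity
    rw [hn, exitP, if_pos hxB]
    positivity
  obtain ⟨n, hnt⟩ : ∃ n : ℕ, n = ⌊t⌋₊ := ⟨_, rfl⟩
  rw [← hnt] at hn ⊢
  have hnt' : (n : ℝ) ≤ t := by rw [hnt]; exact Nat.floor_le ht
  have hn0 : (0 : ℝ) < n := by exact_mod_cast hn
  have hlen : (N : ℝ) * (σ / (2 * N) * R + 1) ≤ σ * R := by
    have : (N : ℝ) * (σ / (2 * N) * R + 1) = σ * R / 2 + N := by field_simp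
    linarith
  have hchain := exitP_boxAt_le_pow hd0 ω (T := (1 + σ) * R) (n := n)
    (show 0 ≤ σ / (2 * N) * R by positivity)
    (fun y hy => hC R hR1 y hy n hn (hnt'.trans htR)) N x (by
      rw [mem_box_iff hd0] at hx ⊢
      linarith)
  refine (exitP_anti hd0 ω (fun y hy => ?_) n x).trans (hchain.trans ?_)
  · rw [mem_boxAt, mem_box_iff hd0] at hy ⊢
    exact hy.trans hlen
  rw [mul_pow, ← Real.rpow_mul_natCast (by positivity)]
  refine mul_le_mul_of_nonneg_left ?_ (by positivity)
  refine (Real.rpow_le_rpow_of_exponent_ge (by positivity) ?_ hNα).trans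
    (Real.rpow_le_rpow (by positivity) (by gcongr) hα.le)
  exact (div_le_one (by positivity)).2 (hnt'.trans htR)


end DetCond
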